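/- Fix integers n ≥ 2, d ≥ 4, s ≥ 2n + 3 and m_1 ≥ m_2 ≥ ⋯ ≥ m_s > 0 satisfying d ≥ m_1 + 2, Σ_{i=1}^s m_i = nd + 2, m_1 + m_{2n+2} ≤ d, and m_1 + m_2 ≤ d + 1. Let S = {p_1,…,p_s} ⊂ P^n be a set of s distinct points in linearly general position and set Z = Σ_{i=1}^s m_i p_i. Then h^1(I_Z(d)) = 0 if and only if S is not contained in any rational normal curve of degree n in P^n. -/

import Mathlib

open MvPolynomial Module

variable {K : Type*} [Field K]

/-- The homogeneous prime ideal of a point of `ℙⁿ`: the ideal generated by the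
linear forms vanishing at the point (equivalently, all homogeneous forms vanishing there). -/
noncomputable def pointIdeal {n : ℕ} (p : Projectivization K (Fin (n + 1) → K)) :
    Ideal (MvPolynomial (Fin (n + 1)) K) :=
  Ideal.span {f | ∃ c : Fin (n + 1) → K,
    (∑ i, c i * p.rep i) = 0 ∧ f = ∑ i, MvPolynomial.C (c i) * MvPolynomial.X i}

/-- The saturated ideal `I_Z = 𝔭₁^{m₁} ∩ ⋯ ∩ 𝔭_s^{m_s}` of the fat point scheme
`Z = Σ m_i p_i`.  (Points with multiplicity `0` contribute the unit ideal.) -/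
noncomputable def fatIdeal {n s : ℕ} (p : Fin s → Projectivization K (Fin (n + 1) → K))
    (m : Fin s → ℕ) : Ideal (MvPolynomial (Fin (n + 1)) K) :=
  ⨅ i, pointIdeal (p i) ^ m i

/-- `dim_K (R/I)_d`: the dimension of the degree-`d` graded piece of `R/I`,
computed as the dimension of the image of the degree-`d` forms in `R/I`. -/
noncomputable def hilbDim {n : ℕ} (I : Ideal (MvPolynomial (Fin (n + 1)) K)) (d : ℕ) : ℕ :=
  Module.finrank K (Submodule.map (Ideal.Quotient.mkₐ K I).toLinearMap
    (homogeneousSubmodule (Fin (n + 1)) K d))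

/-- `Σ_i C(n + m_i − 1, n)`, the expected degree (number of conditions) of a fat point
scheme with multiplicities `m` in `ℙⁿ`. -/
def expDeg {s : ℕ} (n : ℕ) (m : Fin s → ℕ) : ℕ := ∑ i, Nat.choose (n + m i - 1) n

/-- `h¹(I_Z(d)) = 0`, i.e. the fat point scheme imposes independent conditions on
degree-`d` forms. -/
def H1Zero {n s : ℕ} (p : Fin s → Projectivization K (Fin (n + 1) → K)) (m : Fin s → ℕ)
    (d : ℕ) : Prop :=
  hilbDim (fatIdeal p m) d = expDeg n m

/-- The regularity index of the fat point scheme `Z = Σ m_i p_i`: the least `d ≥ 0`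
with `h¹(I_Z(d)) = 0`. -/
noncomputable def regIndex {n s : ℕ} (p : Fin s → Projectivization K (Fin (n + 1) → K))
    (m : Fin s → ℕ) : ℕ :=
  sInf {d | H1Zero p m d}

/-- The set of points of `ℙⁿ` lying in the linear subspace `P(V)`. -/
def projSet {n : ℕ} (V : Submodule K (Fin (n + 1) → K)) :
    Set (Projectivization K (Fin (n + 1) → K)) :=
  {x | x.rep ∈ V}

open Classical in
/-- `w_L(Z)`: the sum of the multiplicities of the points of `Z` lying in `L`. -/
noncomputable def weightIn {n s : ℕ} (p : Fin s → Projectivization K (Fin (n + 1) → K))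
    (m : Fin s → ℕ) (L : Set (Projectivization K (Fin (n + 1) → K))) : ℕ :=
  ∑ i, if p i ∈ L then m i else 0

/-- `C` is a rational normal curve of degree `m` in `ℙⁿ` (`1 ≤ m ≤ n`): the image of the
composite of the degree-`m` Veronese map `ℙ¹ → ℙᵐ`, `[s:t] ↦ [sᵐ : sᵐ⁻¹t : ⋯ : tᵐ]`, with an
injective projective-linear embedding `ℙᵐ → ℙⁿ`. -/
def IsRNC (n m : ℕ) (C : Set (Projectivization K (Fin (n + 1) → K))) : Prop :=
  ∃ g : (Fin (m + 1) → K) →ₗ[K] (Fin (n + 1) → K), Function.Injective g ∧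
    C = {x | ∃ s t : K, (s ≠ 0 ∨ t ≠ 0) ∧
      ∃ h : g (fun j => s ^ (m - (j : ℕ)) * t ^ (j : ℕ)) ≠ 0,
        x = Projectivization.mk K (g (fun j => s ^ (m - (j : ℕ)) * t ^ (j : ℕ))) h}

/-- A set `S` of points of `ℙⁿ` is in linearly general position if every proper linear
subspace `P(V) ⊊ ℙⁿ` (of projective dimension `r = finrank V − 1`) contains at most
`finrank V = r + 1` points of `S`. -/
def LinGenPos {n : ℕ} (S : Set (Projectivization K (Fin (n + 1) → K))) : Prop :=
  ∀ V : Submodule K (Fin (n + 1) → K), V ≠ ⊤ →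
    (S ∩ projSet V).ncard ≤ Module.finrank K V

/-- The linear form with coefficient vector `c`. -/
noncomputable def linForm {n : ℕ} (c : Fin (n + 1) → K) : MvPolynomial (Fin (n + 1)) K :=
  ∑ i, C (c i) * X i

lemma linForm_isHomogeneous {n : ℕ} (c : Fin (n + 1) → K) : (linForm c).IsHomogeneous 1 :=
  IsHomogeneous.sum _ _ _ fun _ _ => isHomogeneous_C_mul_X _ _

lemma eval_linForm {n : ℕ} (c v : Fin (n + 1) → K) : eval v (linForm c) = ∑ i, c i * v i := by
  simp [linForm]

lemma aeval_linForm {n : ℕ} (c : Fin (n + 1) → K) (M : Fin (n + 1) → Fin (n + 1) → K) :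
    aeval (fun i => linForm (M i)) (linForm c) = linForm (fun j => ∑ i, c i * M i j) := by
  simp only [linForm, map_sum, map_mul, aeval_X, algHom_C, algebraMap_eq, Finset.mul_sum,
    Finset.sum_mul]
  rw [Finset.sum_comm]
  simp [mul_assoc]

/-- The linear change of coordinates of the polynomial ring attached to a basis. -/
noncomputable def coordEquiv {n : ℕ} (B : Basis (Fin (n + 1)) K (Fin (n + 1) → K)) :
    MvPolynomial (Fin (n + 1)) K ≃ₐ[K] MvPolynomial (Fin (n + 1)) K :=
  AlgEquiv.ofAlgHom
    (aeval fun i => linForm fun j => B j i)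
    (aeval fun k => linForm fun i => B.repr (Pi.single i 1) k)
    (by
      ext1 k
      simp only [AlgHom.comp_apply, aeval_X, AlgHom.id_apply]
      rw [aeval_linForm]
      have h : ∀ j, ∑ i, B.repr (Pi.single i 1) k * B j i = if j = k then 1 else 0 := by
        intro j
        have h1 : B.repr (B j) k = if j = k then 1 else 0 := by
          simp [Finsupp.single_apply]
        rw [← h1]
        conv_rhs => rw [← (Pi.basisFun K (Fin (n + 1))).sum_repr (B j)]
        simp [Finsupp.finsetSum_apply, mul_comm]
      simp [linForm, h])
    (by
      ext1 i
      simp only [AlgHom.comp_apply, aeval_X, AlgHom.id_apply]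
      rw [aeval_linForm]
      have h : ∀ l, ∑ k, B k i * B.repr (Pi.single l 1) k = if l = i then 1 else 0 := by
        intro l
        have h1 := congrFun (B.sum_repr (Pi.single l 1)) i
        simp only [Finset.sum_apply, Pi.smul_apply, smul_eq_mul] at h1
        simp only [mul_comm (B _ i), h1, Pi.single_apply, eq_comm]
      simp [linForm, h])

lemma coordEquiv_linForm {n : ℕ} (B : Basis (Fin (n + 1)) K (Fin (n + 1) → K))
    (c : Fin (n + 1) → K) :
    coordEquiv B (linForm c) = linForm fun j => ∑ i, c i * B j i :=
  aeval_linForm c fun i j => B j i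

lemma coordEquiv_symm_X {n : ℕ} (B : Basis (Fin (n + 1)) K (Fin (n + 1) → K)) (k : Fin (n + 1)) :
    (coordEquiv B).symm (X k) = linForm fun i => B.repr (Pi.single i 1) k :=
  aeval_X _ _

lemma coordEquiv_isHomogeneous {n d : ℕ} (B : Basis (Fin (n + 1)) K (Fin (n + 1) → K))
    {f : MvPolynomial (Fin (n + 1)) K} (hf : f.IsHomogeneous d) :
    (coordEquiv B f).IsHomogeneous d := by
  have := hf.aeval (fun i => linForm fun j => B j i) (n := 1) fun _ => linForm_isHomogeneous _
  exact one_mul d ▸ this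

lemma coordEquiv_symm_isHomogeneous {n d : ℕ} (B : Basis (Fin (n + 1)) K (Fin (n + 1) → K))
    {f : MvPolynomial (Fin (n + 1)) K} (hf : f.IsHomogeneous d) :
    ((coordEquiv B).symm f).IsHomogeneous d := by
  have := hf.aeval (fun k => linForm fun i => B.repr (Pi.single i 1) k) (n := 1)
    fun _ => linForm_isHomogeneous _
  exact one_mul d ▸ this

lemma eval_coordEquiv {n : ℕ} (B : Basis (Fin (n + 1)) K (Fin (n + 1) → K))
    (w : Fin (n + 1) → K) (f : MvPolynomial (Fin (n + 1)) K) :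
    eval w (coordEquiv B f) = eval (fun i => ∑ j, B j i * w j) f := by
  have h : (aeval w).comp (coordEquiv B).toAlgHom
      = (aeval (fun i => ∑ j, B j i * w j) : MvPolynomial (Fin (n + 1)) K →ₐ[K] K) := by
    ext1 i
    have : coordEquiv B (X i) = linForm fun j => B j i := aeval_X _ _
    simp [this, linForm]
  have := DFunLike.congr_fun h f
  exact this

/-- The total degree of an exponent vector in all variables but the first. -/
def tailDeg {n : ℕ} (e : Fin (n + 1) →₀ ℕ) : ℕ := ∑ k : Fin n, e k.succ

lemma tailDeg_add {n : ℕ} (e e' : Fin (n + 1) →₀ ℕ) :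
    tailDeg (e + e') = tailDeg e + tailDeg e' := by
  simp [tailDeg, Finset.sum_add_distrib]

lemma degree_eq_add_tailDeg {n : ℕ} (e : Fin (n + 1) →₀ ℕ) : e.degree = e 0 + tailDeg e := by
  rw [Finsupp.degree_eq_sum, Fin.sum_univ_succ, tailDeg]

/-- Polynomials all of whose monomials have degree at least `m` in the last `n` variables. -/
def tailIdeal (K : Type*) [Field K] (n m : ℕ) : Ideal (MvPolynomial (Fin (n + 1)) K) where
  carrier := {f | ∀ e, coeff e f ≠ 0 → m ≤ tailDeg e}
  zero_mem' := by simp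
  add_mem' := by
    intro f g hf hg e he
    by_cases h : coeff e f = 0
    · exact hg e (by simpa [h] using he)
    · exact hf e h
  smul_mem' := by
    intro f g hg e he
    rw [smul_eq_mul, coeff_mul] at he
    obtain ⟨x, hx, hne⟩ := Finset.exists_ne_zero_of_sum_ne_zero he
    have := hg x.2 (right_ne_zero_of_mul hne)
    rw [← Finset.HasAntidiagonal.mem_antidiagonal.1 hx, tailDeg_add]
    omega

lemma mem_tailIdeal {n m : ℕ} {f : MvPolynomial (Fin (n + 1)) K} :
    f ∈ tailIdeal K n m ↔ ∀ e, coeff e f ≠ 0 → m ≤ tailDeg e := Iff.rfl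

lemma tailIdeal_mul_le (n a b : ℕ) :
    tailIdeal K n a * tailIdeal K n b ≤ tailIdeal K n (a + b) := by
  rw [Ideal.mul_le]
  intro f hf g hg e he
  rw [coeff_mul] at he
  obtain ⟨x, hx, hne⟩ := Finset.exists_ne_zero_of_sum_ne_zero he
  have h1 := hf x.1 (left_ne_zero_of_mul hne)
  have h2 := hg x.2 (right_ne_zero_of_mul hne)
  rw [← Finset.HasAntidiagonal.mem_antidiagonal.1 hx, tailDeg_add]
  omega

lemma span_X_succ_pow (n m : ℕ) :
    Ideal.span (Set.range fun k : Fin n => (X k.succ : MvPolynomial (Fin (n + 1)) K)) ^ m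
      = tailIdeal K n m := by
  apply le_antisymm
  · induction m with
    | zero => intro f _ e _; exact Nat.zero_le _
    | succ m ih =>
      rw [pow_succ]
      refine (Ideal.mul_mono ih ?_).trans (tailIdeal_mul_le n m 1)
      rw [Ideal.span_le]
      rintro _ ⟨k, rfl⟩ e he
      simp only [coeff_X, ne_eq, ite_eq_right_iff, one_ne_zero, imp_false, not_not] at he
      subst he
      have : (1 : ℕ) = (Finsupp.single k.succ 1 : Fin (n + 1) →₀ ℕ) k.succ := by simp
      conv_lhs => rw [this]
      exact Finset.single_le_sum (f := fun l : Fin n =>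
        (Finsupp.single k.succ 1 : Fin (n + 1) →₀ ℕ) l.succ) (fun _ _ => Nat.zero_le _)
        (Finset.mem_univ k)
  · intro f hf
    rw [f.as_sum]
    refine Ideal.sum_mem _ fun e he => ?_
    have hm := hf e (mem_support_iff.1 he)
    rw [monomial_eq, Finsupp.prod_fintype _ _ (by simp), Fin.prod_univ_succ]
    refine Ideal.mul_mem_left _ _ (Ideal.mul_mem_left _ _ ?_)
    refine Ideal.pow_le_pow_right hm ?_
    rw [tailDeg, ← Finset.prod_pow_eq_pow_sum]
    exact Ideal.prod_mem_prod fun k _ =>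
      Ideal.pow_mem_pow (Ideal.subset_span (Set.mem_range_self k)) _

lemma linForm_mem_pointIdeal {n : ℕ} {p : Projectivization K (Fin (n + 1) → K)}
    {c : Fin (n + 1) → K} (h : ∑ i, c i * p.rep i = 0) : linForm c ∈ pointIdeal p :=
  Ideal.subset_span ⟨c, h, rfl⟩

lemma coordEquiv_symm_X_succ_mem {n : ℕ} {B : Basis (Fin (n + 1)) K (Fin (n + 1) → K)}
    {p : Projectivization K (Fin (n + 1) → K)} {j k : Fin (n + 1)} (hB : B j = p.rep)
    (hjk : j ≠ k) : (coordEquiv B).symm (X k) ∈ pointIdeal p := by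
  rw [coordEquiv_symm_X]
  apply linForm_mem_pointIdeal
  have h : B.repr (B j) k = 0 := by simp [hjk]
  rw [← h, hB]
  conv_rhs => rw [← (Pi.basisFun K (Fin (n + 1))).sum_repr p.rep]
  simp [Finsupp.finsetSum_apply, mul_comm]

lemma map_pointIdeal {n : ℕ} {B : Basis (Fin (n + 1)) K (Fin (n + 1) → K)}
    {p : Projectivization K (Fin (n + 1) → K)} (hB : B 0 = p.rep) :
    (pointIdeal p).map (coordEquiv B)
      = Ideal.span (Set.range fun k : Fin n => (X k.succ : MvPolynomial (Fin (n + 1)) K)) := by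
  apply le_antisymm
  · rw [Ideal.map_le_iff_le_comap, pointIdeal, Ideal.span_le]
    rintro _ ⟨c, hc, rfl⟩
    change coordEquiv B (linForm c) ∈ Ideal.span _
    rw [coordEquiv_linForm, linForm, Fin.sum_univ_succ, hB, hc]
    simp only [map_zero, zero_mul, zero_add]
    exact Ideal.sum_mem _ fun k _ => Ideal.mul_mem_left _ _
      (Ideal.subset_span (Set.mem_range_self k))
  · rw [Ideal.span_le]
    rintro _ ⟨k, rfl⟩
    have := Ideal.mem_map_of_mem (coordEquiv B)
      (coordEquiv_symm_X_succ_mem hB (Fin.succ_ne_zero k).symm)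
    simpa using this

lemma mem_pointIdeal_pow_iff {n m : ℕ} {B : Basis (Fin (n + 1)) K (Fin (n + 1) → K)}
    {p : Projectivization K (Fin (n + 1) → K)} (hB : B 0 = p.rep)
    {f : MvPolynomial (Fin (n + 1)) K} :
    f ∈ pointIdeal p ^ m ↔ coordEquiv B f ∈ tailIdeal K n m := by
  rw [← span_X_succ_pow, ← map_pointIdeal hB, ← Ideal.map_pow]
  constructor
  · exact Ideal.mem_map_of_mem _
  · intro h
    obtain ⟨x, hx, hxf⟩ := (Ideal.mem_map_of_equiv (coordEquiv B) _).1 h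
    rwa [← (coordEquiv B).injective hxf]

lemma eq_single_of_tailDeg_eq_zero {n d : ℕ} {e : Fin (n + 1) →₀ ℕ} (hd : e.degree = d)
    (h : tailDeg e = 0) : e = Finsupp.single 0 d := by
  rw [degree_eq_add_tailDeg, h, add_zero] at hd
  ext i
  refine Fin.cases ?_ (fun k => ?_) i
  · simpa using hd
  · rw [tailDeg, Finset.sum_eq_zero_iff] at h
    simpa [Finsupp.single_apply, (Fin.succ_ne_zero k).symm] using h k (Finset.mem_univ k)

lemma eval_eq_zero_of_mem_tailIdeal_one {n : ℕ} {f : MvPolynomial (Fin (n + 1)) K}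
    (hf : f ∈ tailIdeal K n 1) : eval (Pi.single 0 1) f = 0 := by
  rw [← span_X_succ_pow, pow_one] at hf
  have : Ideal.span (Set.range fun k : Fin n => (X k.succ : MvPolynomial (Fin (n + 1)) K))
      ≤ RingHom.ker (eval (Pi.single 0 1 : Fin (n + 1) → K)) := by
    rw [Ideal.span_le]
    rintro _ ⟨k, rfl⟩
    simp [RingHom.mem_ker]
  exact this hf

lemma mem_pointIdeal_of_eval_eq_zero {n d : ℕ} {B : Basis (Fin (n + 1)) K (Fin (n + 1) → K)}
    {p : Projectivization K (Fin (n + 1) → K)} (hB : B 0 = p.rep)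
    {f : MvPolynomial (Fin (n + 1)) K} (hf : f.IsHomogeneous d) (h0 : eval p.rep f = 0) :
    f ∈ pointIdeal p := by
  rw [← pow_one (pointIdeal p), mem_pointIdeal_pow_iff hB]
  have hg := coordEquiv_isHomogeneous B hf
  have he : eval (Pi.single 0 1) (coordEquiv B f) = 0 := by
    rw [eval_coordEquiv, ← h0]
    congr 2
    ext i
    simp [Pi.single_apply, ← hB]
  set g := coordEquiv B f
  set a := coeff (Finsupp.single 0 d) g
  have hsub : g - monomial (Finsupp.single 0 d) a ∈ tailIdeal K n 1 := by
    intro e hne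
    by_contra hlt
    have h1 : tailDeg e = 0 := by omega
    by_cases hd : e.degree = d
    · have := eq_single_of_tailDeg_eq_zero hd h1
      subst this
      simp [a] at hne
    · have h2 : e ≠ Finsupp.single 0 d := by
        rintro rfl
        simp at hd
      simp [coeff_monomial, hg.coeff_eq_zero hd, h2.symm] at hne
  have ha : a = 0 := by
    have := eval_eq_zero_of_mem_tailIdeal_one hsub
    simpa [he, eval_monomial] using this
  simpa [ha] using hsub

instance homogeneousSubmodule_finite (n d : ℕ) :
    FiniteDimensional K (homogeneousSubmodule (Fin (n + 1)) K d) :=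
  Module.Finite.iff_fg.2 (homogeneousSubmodule_fg _ _ d)

/-- The exponent vectors of degree `d` and tail degree less than `m`. -/
noncomputable def lowTail (n d m : ℕ) : Finset (Fin (n + 1) →₀ ℕ) :=
  (Finset.univ.finsuppAntidiag (m - 1)).map (addRightEmbedding (Finsupp.single 0 (d + 1 - m)))

lemma mem_lowTail {n d m : ℕ} (hm : 0 < m) (hmd : m ≤ d + 1) {e : Fin (n + 1) →₀ ℕ} :
    e ∈ lowTail n d m ↔ e.degree = d ∧ tailDeg e < m := by
  have hs : tailDeg (Finsupp.single 0 (d + 1 - m) : Fin (n + 1) →₀ ℕ) = 0 := by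
    simp [tailDeg]
  simp only [lowTail, Finset.mem_map, Finset.mem_finsuppAntidiag, addRightEmbedding_apply,
    Finset.subset_univ, and_true]
  constructor
  · rintro ⟨a, ha, rfl⟩
    rw [← Finsupp.degree_eq_sum] at ha
    have := degree_eq_add_tailDeg a
    refine ⟨?_, ?_⟩
    · rw [map_add, Finsupp.degree_single]; omega
    · rw [tailDeg_add, hs]; omega
  · rintro ⟨h1, h2⟩
    have h3 := degree_eq_add_tailDeg e
    have hle : Finsupp.single 0 (d + 1 - m) ≤ e := by
      rw [Finsupp.single_le_iff]; omega
    have h4 : e - Finsupp.single 0 (d + 1 - m) + Finsupp.single 0 (d + 1 - m) = e :=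
      tsub_add_cancel_of_le hle
    refine ⟨e - Finsupp.single 0 (d + 1 - m), ?_, h4⟩
    rw [← Finsupp.degree_eq_sum]
    have h5 := congrArg Finsupp.degree h4
    rw [map_add, Finsupp.degree_single] at h5
    omega

lemma card_lowTail {n d m : ℕ} (hm : 0 < m) : (lowTail n d m).card = (n + m - 1).choose n := by
  rw [lowTail, Finset.card_map, Finset.card_finsuppAntidiag_nat_eq_choose, Finset.card_univ,
    Fintype.card_fin, show n + 1 + (m - 1) - 1 = n + m - 1 by omega]
  exact Nat.choose_symm_of_eq_add (by omega)

lemma finrank_inf_pointIdeal_pow {n d m : ℕ} {B : Basis (Fin (n + 1)) K (Fin (n + 1) → K)}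
    {p : Projectivization K (Fin (n + 1) → K)} (hB : B 0 = p.rep) (hm : 0 < m)
    (hmd : m ≤ d + 1) :
    finrank K ↥(homogeneousSubmodule (Fin (n + 1)) K d ⊓
        (pointIdeal p ^ m).restrictScalars K) + (n + m - 1).choose n
      = finrank K (homogeneousSubmodule (Fin (n + 1)) K d) := by
  let φ : homogeneousSubmodule (Fin (n + 1)) K d →ₗ[K] (lowTail n d m → K) :=
    LinearMap.pi fun e => (lcoeff K e.1) ∘ₗ (coordEquiv B).toLinearMap ∘ₗ Submodule.subtype _
  have hφ : ∀ f e, φ f e = coeff e.1 (coordEquiv B f.1) := fun f e => rfl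
  have hrange : LinearMap.range φ = ⊤ := by
    rw [LinearMap.range_eq_top]
    intro g
    have hh : (∑ e : lowTail n d m, monomial e.1 (g e)).IsHomogeneous d :=
      IsHomogeneous.sum _ _ _ fun e _ =>
        isHomogeneous_monomial _ ((mem_lowTail hm hmd).1 e.2).1
    refine ⟨⟨(coordEquiv B).symm (∑ e : lowTail n d m, monomial e.1 (g e)),
      coordEquiv_symm_isHomogeneous B hh⟩, ?_⟩
    ext e
    rw [hφ, AlgEquiv.apply_symm_apply]
    simp [coeff_sum, coeff_monomial]
  have hker : LinearMap.ker φ = Submodule.comap (Submodule.subtype _)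
      ((pointIdeal p ^ m).restrictScalars K) := by
    ext f
    rw [LinearMap.mem_ker, Submodule.mem_comap, Submodule.restrictScalars_mem,
      Submodule.subtype_apply, mem_pointIdeal_pow_iff hB, mem_tailIdeal]
    have hg := coordEquiv_isHomogeneous B f.2
    constructor
    · intro h e he
      by_contra hlt
      have hd : e.degree = d := by
        by_contra hd
        exact he (hg.coeff_eq_zero hd)
      exact he (congrFun h ⟨e, (mem_lowTail hm hmd).2 ⟨hd, by omega⟩⟩)
    · intro h
      ext e
      by_contra hne
      have h1 := h e.1 hne
      have h2 := ((mem_lowTail hm hmd).1 e.2).2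
      omega
  have := φ.finrank_range_add_finrank_ker
  rw [hrange, hker, finrank_top, Module.finrank_fintype_fun_eq_card, Fintype.card_coe,
    card_lowTail hm, ← Submodule.finrank_map_subtype_eq, Submodule.map_comap_subtype] at this
  omega

/-- The degree `d` forms vanishing to order `m j` at `p j` for all `j ∈ E`. -/
noncomputable def fatForms {n s : ℕ} (p : Fin s → Projectivization K (Fin (n + 1) → K))
    (m : Fin s → ℕ) (d : ℕ) (E : Finset (Fin s)) :
    Submodule K (MvPolynomial (Fin (n + 1)) K) :=
  homogeneousSubmodule (Fin (n + 1)) K d ⊓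
    (⨅ j ∈ E, pointIdeal (p j) ^ m j).restrictScalars K

section FatForms

variable {n s d : ℕ} {p : Fin s → Projectivization K (Fin (n + 1) → K)} {m : Fin s → ℕ}

lemma mem_fatForms {E : Finset (Fin s)} {f : MvPolynomial (Fin (n + 1)) K} :
    f ∈ fatForms p m d E ↔ f.IsHomogeneous d ∧ ∀ j ∈ E, f ∈ pointIdeal (p j) ^ m j := by
  simp [fatForms, Submodule.mem_inf]

instance fatForms_finite (E : Finset (Fin s)) : FiniteDimensional K (fatForms p m d E) :=
  Submodule.finiteDimensional_of_le
    (inf_le_left : _ ≤ homogeneousSubmodule (Fin (n + 1)) K d)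

lemma fatForms_le (E : Finset (Fin s)) :
    fatForms p m d E ≤ homogeneousSubmodule (Fin (n + 1)) K d := inf_le_left

lemma fatForms_insert (E : Finset (Fin s)) (k : Fin s) :
    fatForms p m d (insert k E) = fatForms p m d E ⊓ fatForms p m d {k} := by
  ext f
  simp only [Submodule.mem_inf, mem_fatForms, Finset.forall_mem_insert, Finset.mem_singleton,
    forall_eq]
  tauto

lemma fatForms_empty : fatForms p m d ∅ = homogeneousSubmodule (Fin (n + 1)) K d := by
  ext f
  simp [mem_fatForms]

lemma finrank_sup_add_finrank_fatForms_insert (E : Finset (Fin s)) (k : Fin s) :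
    finrank K ↥(fatForms p m d E ⊔ fatForms p m d {k}) + finrank K (fatForms p m d (insert k E))
      = finrank K (fatForms p m d E) + finrank K (fatForms p m d {k}) := by
  rw [fatForms_insert]
  exact Submodule.finrank_sup_add_finrank_inf_eq _ _

lemma sup_fatForms_le (E E' : Finset (Fin s)) :
    fatForms p m d E ⊔ fatForms p m d E' ≤ homogeneousSubmodule (Fin (n + 1)) K d :=
  sup_le (fatForms_le _) (fatForms_le _)

lemma finrank_fatForms_singleton {B : Basis (Fin (n + 1)) K (Fin (n + 1) → K)} {k : Fin s}
    (hB : B 0 = (p k).rep) (hm : 0 < m k) (hmd : m k ≤ d + 1) :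
    finrank K (fatForms p m d {k}) + (n + m k - 1).choose n
      = finrank K (homogeneousSubmodule (Fin (n + 1)) K d) := by
  have h : fatForms p m d {k} = homogeneousSubmodule (Fin (n + 1)) K d ⊓
      (pointIdeal (p k) ^ m k).restrictScalars K := by
    ext f
    simp [mem_fatForms]
  rw [h, finrank_inf_pointIdeal_pow hB hm hmd]

lemma finrank_le_fatForms_add
    (hrank : ∀ k, finrank K (fatForms p m d {k}) + (n + m k - 1).choose n
      = finrank K (homogeneousSubmodule (Fin (n + 1)) K d)) (E : Finset (Fin s)) :
    finrank K (homogeneousSubmodule (Fin (n + 1)) K d)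
      ≤ finrank K (fatForms p m d E) + ∑ j ∈ E, (n + m j - 1).choose n := by
  induction E using Finset.induction_on with
  | empty => rw [fatForms_empty]; exact Nat.le_add_right _ _
  | insert k E hk ih =>
    rw [Finset.sum_insert hk]
    have h1 := finrank_sup_add_finrank_fatForms_insert (p := p) (m := m) (d := d) E k
    have h2 := hrank k
    have h3 := Submodule.finrank_mono (sup_fatForms_le (p := p) (m := m) (d := d) E {k})
    omega

lemma finrank_fatForms_insert_add
    (hrank : ∀ k, finrank K (fatForms p m d {k}) + (n + m k - 1).choose n
      = finrank K (homogeneousSubmodule (Fin (n + 1)) K d)) {E : Finset (Fin s)} {k : Fin s}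
    (hk : k ∉ E)
    (hE : finrank K (fatForms p m d E) + ∑ j ∈ E, (n + m j - 1).choose n
      = finrank K (homogeneousSubmodule (Fin (n + 1)) K d)) :
    finrank K (fatForms p m d (insert k E)) + ∑ j ∈ insert k E, (n + m j - 1).choose n
      = finrank K (homogeneousSubmodule (Fin (n + 1)) K d) ↔
    homogeneousSubmodule (Fin (n + 1)) K d ≤ fatForms p m d E ⊔ fatForms p m d {k} := by
  rw [Finset.sum_insert hk]
  have h1 := finrank_sup_add_finrank_fatForms_insert (p := p) (m := m) (d := d) E k
  have h2 := hrank k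
  have h3 := sup_fatForms_le (p := p) (m := m) (d := d) E {k}
  constructor
  · intro h
    exact (Submodule.eq_of_le_of_finrank_eq h3 (by omega)).ge
  · intro h
    rw [le_antisymm h3 h] at h1
    omega

lemma sup_fatForms_of_finrank_eq
    (hrank : ∀ k, finrank K (fatForms p m d {k}) + (n + m k - 1).choose n
      = finrank K (homogeneousSubmodule (Fin (n + 1)) K d)) {E : Finset (Fin s)} {k : Fin s}
    (hk : k ∉ E)
    (h : finrank K (fatForms p m d (insert k E)) + ∑ j ∈ insert k E, (n + m j - 1).choose n
      = finrank K (homogeneousSubmodule (Fin (n + 1)) K d)) :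
    homogeneousSubmodule (Fin (n + 1)) K d ≤ fatForms p m d E ⊔ fatForms p m d {k} := by
  refine (finrank_fatForms_insert_add hrank hk ?_).1 h
  rw [Finset.sum_insert hk] at h
  have h1 := finrank_sup_add_finrank_fatForms_insert (p := p) (m := m) (d := d) E k
  have h2 := hrank k
  have h3 := Submodule.finrank_mono (sup_fatForms_le (p := p) (m := m) (d := d) E {k})
  have h4 := finrank_le_fatForms_add hrank E
  omega

lemma H1Zero_iff_finrank :
    H1Zero p m d ↔ finrank K (fatForms p m d Finset.univ)
        + ∑ j ∈ Finset.univ, (n + m j - 1).choose n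
      = finrank K (homogeneousSubmodule (Fin (n + 1)) K d) := by
  set A := homogeneousSubmodule (Fin (n + 1)) K d
  let φ := (Ideal.Quotient.mkₐ K (fatIdeal p m)).toLinearMap
  have hk : LinearMap.ker φ = (fatIdeal p m).restrictScalars K := by
    ext f
    exact Ideal.Quotient.eq_zero_iff_mem
  have h1 := (φ.domRestrict A).finrank_range_add_finrank_ker
  have h2 : finrank K (LinearMap.ker (φ.domRestrict A)) =
      finrank K (fatForms p m d Finset.univ) := by
    have h : A ⊓ (fatIdeal p m).restrictScalars K = fatForms p m d Finset.univ := by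
      ext f
      simp [mem_fatForms, fatIdeal, A]
    rw [LinearMap.ker_domRestrict, hk, ← Submodule.finrank_map_subtype_eq,
      Submodule.map_comap_subtype, h]
  rw [LinearMap.range_domRestrict, h2] at h1
  have h3 : hilbDim (fatIdeal p m) d = finrank K (Submodule.map φ A) := rfl
  rw [H1Zero, h3, expDeg]
  omega

end FatForms

section GeneralPosition

variable {n s : ℕ} {p : Fin s → Projectivization K (Fin (n + 1) → K)}

lemma card_le_finrank_of_linGenPos (hinj : Function.Injective p)
    (hlgp : LinGenPos (Set.range p)) {V : Submodule K (Fin (n + 1) → K)} (hV : V ≠ ⊤)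
    {A : Finset (Fin s)} (hA : ∀ j ∈ A, (p j).rep ∈ V) : A.card ≤ finrank K V := by
  refine le_trans ?_ (hlgp V hV)
  rw [← Set.ncard_coe_finset, ← Set.ncard_image_of_injective _ hinj]
  refine Set.ncard_le_ncard ?_ ((Set.finite_range p).inter_of_left _)
  rintro _ ⟨j, hj, rfl⟩
  exact ⟨⟨j, rfl⟩, hA j hj⟩

lemma span_rep_eq_top (hinj : Function.Injective p) (hlgp : LinGenPos (Set.range p))
    {A : Finset (Fin s)} (hA : n + 1 ≤ A.card) :
    Submodule.span K ((fun j => (p j).rep) '' (A : Set (Fin s))) = ⊤ := by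
  by_contra hV
  have h1 := card_le_finrank_of_linGenPos hinj hlgp hV (A := A)
    fun j hj => Submodule.subset_span ⟨j, hj, rfl⟩
  have h2 := Submodule.finrank_lt hV
  rw [Module.finrank_fin_fun] at h2
  omega

lemma exists_hyperplane (hinj : Function.Injective p) (hlgp : LinGenPos (Set.range p))
    {A : Finset (Fin s)} (hA : A.card ≤ n) {x : Fin s} (hx : x ∉ A) :
    ∃ c : Fin (n + 1) → K, (∀ j ∈ A, ∑ i, c i * (p j).rep i = 0) ∧
      ∑ i, c i * (p x).rep i ≠ 0 := by
  classical
  set V := Submodule.span K (((A.image fun j => (p j).rep) : Finset _) : Set (Fin (n + 1) → K))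
  have hfin : finrank K V ≤ A.card :=
    (finrank_span_finset_le_card _).trans Finset.card_image_le
  have hmem : ∀ j ∈ A, (p j).rep ∈ V := fun j hj =>
    Submodule.subset_span (by simpa using ⟨j, hj, rfl⟩)
  have hV : V ≠ ⊤ := by
    intro h
    rw [h, finrank_top, Module.finrank_fin_fun] at hfin
    omega
  have hxV : (p x).rep ∉ V := by
    intro hxV
    have := card_le_finrank_of_linGenPos hinj hlgp hV (A := insert x A) (by
      simpa [Finset.forall_mem_insert] using ⟨hxV, hmem⟩)
    rw [Finset.card_insert_of_notMem hx] at this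
    omega
  obtain ⟨f, hf, hVf⟩ := Submodule.exists_le_ker_of_notMem hxV
  have key : ∀ v : Fin (n + 1) → K, ∑ i, f (Pi.single i 1) * v i = f v := by
    intro v
    rw [f.pi_apply_eq_sum_univ v]
    refine Finset.sum_congr rfl fun i _ => ?_
    rw [smul_eq_mul, mul_comm]
    congr 2
    ext j
    simp [Pi.single_apply, eq_comm]
  refine ⟨fun i => f (Pi.single i 1), fun j hj => ?_, ?_⟩
  · rw [key]
    exact hVf (hmem j hj)
  · rw [key]
    exact hf

lemma eq_zero_of_vanishing (hinj : Function.Injective p) (hlgp : LinGenPos (Set.range p))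
    {A : Finset (Fin s)} (hA : n + 1 ≤ A.card) {c : Fin (n + 1) → K}
    (hc : ∀ j ∈ A, ∑ i, c i * (p j).rep i = 0) : c = 0 := by
  have h : Submodule.span K ((fun j => (p j).rep) '' (A : Set (Fin s)))
      ≤ LinearMap.ker (dotProductBilin K K c) := by
    rw [Submodule.span_le]
    rintro _ ⟨j, hj, rfl⟩
    exact hc j hj
  rw [span_rep_eq_top hinj hlgp hA] at h
  exact dotProduct_eq_zero c fun v => h (Submodule.mem_top (x := v))

lemma exists_basis_of_linGenPos (hinj : Function.Injective p) (hlgp : LinGenPos (Set.range p))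
    {q : Fin (n + 1) → Fin s} (hq : Function.Injective q) :
    ∃ B : Basis (Fin (n + 1)) K (Fin (n + 1) → K), ∀ k, B k = (p (q k)).rep := by
  have h := span_rep_eq_top hinj hlgp (A := Finset.univ.map ⟨q, hq⟩) (by simp)
  refine ⟨basisOfTopLeSpanOfCardEqFinrank (fun k => (p (q k)).rep) (h.ge.trans ?_) (by simp),
    fun k => by simp⟩
  apply Submodule.span_mono
  rintro _ ⟨j, hj, rfl⟩
  obtain ⟨k, -, rfl⟩ := Finset.mem_map.1 hj
  exact ⟨k, rfl⟩

/-- A product of hyperplanes with prescribed multiplicities avoiding one of the points. -/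
lemma exists_form_of_weights (hinj : Function.Injective p) (hlgp : LinGenPos (Set.range p))
    (x : Fin s) (t : ℕ) (w : Fin s → ℕ) (hx : w x = 0) (hle : ∀ j, w j ≤ t)
    (hsum : ∑ j, w j ≤ n * t) :
    ∃ F : MvPolynomial (Fin (n + 1)) K, F.IsHomogeneous t ∧ eval (p x).rep F ≠ 0 ∧
      ∀ j, F ∈ pointIdeal (p j) ^ w j := by
  classical
  induction t generalizing w with
  | zero =>
    refine ⟨1, isHomogeneous_one _ _, by simp, fun j => ?_⟩
    simp [Nat.le_zero.1 (hle j)]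
  | succ t ih =>
    set P := Finset.univ.filter fun j => 0 < w j
    set M := Finset.univ.filter fun j => w j = t + 1
    have hMP : M ⊆ P := by
      intro j hj
      simp only [M, P, Finset.mem_filter, Finset.mem_univ, true_and] at hj ⊢
      omega
    have hMn : M.card ≤ n := by
      have : M.card * (t + 1) ≤ n * (t + 1) := by
        refine le_trans ?_ hsum
        rw [← smul_eq_mul, ← Finset.sum_const]
        refine le_trans (Finset.sum_le_sum fun j hj => ?_)
          (Finset.sum_le_sum_of_subset (Finset.subset_univ M))
        exact (Finset.mem_filter.1 hj).2.ge
      exact Nat.le_of_mul_le_mul_right this (by omega)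
    obtain ⟨A, hMA, hAP, hAn, hA⟩ : ∃ A, M ⊆ A ∧ A ⊆ P ∧ A.card ≤ n ∧ (A.card = n ∨ A = P) := by
      by_cases hP : n ≤ P.card
      · obtain ⟨A, h1, h2, h3⟩ := Finset.exists_subsuperset_card_eq hMP hMn hP
        exact ⟨A, h1, h2, h3.le, Or.inl h3⟩
      · exact ⟨P, hMP, subset_rfl, by omega, Or.inr rfl⟩
    have hxA : x ∉ A := by
      intro h
      have := (Finset.mem_filter.1 (hAP h)).2
      omega
    have hsplit : ∀ j, w j = (w j - if j ∈ A then 1 else 0) + if j ∈ A then 1 else 0 := by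
      intro j
      split_ifs with h
      · have := (Finset.mem_filter.1 (hAP h)).2
        omega
      · rfl
    have hle' : ∀ j, (w j - if j ∈ A then 1 else 0) ≤ t := by
      intro j
      have h1 := hle j
      by_cases h : j ∈ A
      · simp only [h, if_true]; omega
      · have h2 : w j ≠ t + 1 := fun h2 => h (hMA (by simp [M, h2]))
        simp only [h, if_false]; omega
    have hS : ∑ j, w j = ∑ j, (w j - if j ∈ A then 1 else 0) + A.card := by
      conv_lhs => rw [Finset.sum_congr rfl fun j _ => hsplit j]
      rw [Finset.sum_add_distrib]
      simp
    obtain ⟨F, hF, hFx, hFj⟩ := ih (fun j => w j - if j ∈ A then 1 else 0) (by simp [hx]) hle' (by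
      rcases hA with hA | hA
      · rw [hS, hA, Nat.mul_succ] at hsum
        omega
      · have h0 : ∀ j ∉ A, (w j - if j ∈ A then 1 else 0) = 0 := by
          intro j hj
          rw [hA] at hj
          simp only [P, Finset.mem_filter, Finset.mem_univ, true_and] at hj
          omega
        rw [← Finset.sum_subset (Finset.subset_univ A) fun j _ hj => h0 j hj]
        refine (Finset.sum_le_card_nsmul _ _ t fun j _ => hle' j).trans ?_
        rw [smul_eq_mul]
        exact Nat.mul_le_mul_right _ hAn)
    obtain ⟨c, hcA, hcx⟩ := exists_hyperplane hinj hlgp hAn hxA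
    refine ⟨F * linForm c, hF.mul (linForm_isHomogeneous c), ?_, fun j => ?_⟩
    · rw [map_mul, eval_linForm]
      exact mul_ne_zero hFx hcx
    · rw [hsplit j, pow_add]
      refine Ideal.mul_mem_mul (hFj j) ?_
      split_ifs with h
      · rw [pow_one]
        exact linForm_mem_pointIdeal (hcA j h)
      · simp

/-- If, in coordinates centred at `p x` and `n` further points of the scheme, all low order leading
monomials are realised by forms in the other ideals, then `p x` imposes independent conditions. -/
lemma le_sup_fatForms {m : Fin s → ℕ} {d : ℕ} {x : Fin s} {q : Fin n → Fin s}
    {B : Basis (Fin (n + 1)) K (Fin (n + 1) → K)} (hB0 : B 0 = (p x).rep)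
    (hBq : ∀ k, B (Fin.succ k) = (p (q k)).rep) (D : Finset (Fin s))
    (hF : ∀ e : Fin n → ℕ, ∑ k, e k < m x → ∑ k, e k ≤ d →
      ∃ F : MvPolynomial (Fin (n + 1)) K,
        F.IsHomogeneous (d - ∑ k, e k) ∧ eval (p x).rep F ≠ 0 ∧
        (∀ j ∈ D, j ∉ Set.range q → F ∈ pointIdeal (p j) ^ m j) ∧
        ∀ k, q k ∈ D → F ∈ pointIdeal (p (q k)) ^ (m (q k) - (∑ k, e k - e k))) :
    homogeneousSubmodule (Fin (n + 1)) K d ≤ fatForms p m d D ⊔ fatForms p m d {x} := by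
  suffices h : ∀ N r, m x ≤ r + N → ∀ f : MvPolynomial (Fin (n + 1)) K, f.IsHomogeneous d →
      f ∈ pointIdeal (p x) ^ r → f ∈ fatForms p m d D ⊔ fatForms p m d {x} by
    intro f hf
    exact h (m x) 0 (by omega) f hf (by simp)
  intro N
  induction N with
  | zero =>
    intro r hr f hf hfr
    refine Submodule.mem_sup_right (mem_fatForms.2 ⟨hf, ?_⟩)
    simpa using Ideal.pow_le_pow_right hr hfr
  | succ N ih =>
    intro r hr f hf hfr
    by_cases hmr : m x ≤ r
    · refine Submodule.mem_sup_right (mem_fatForms.2 ⟨hf, ?_⟩)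
      simpa using Ideal.pow_le_pow_right hmr hfr
    have hg := coordEquiv_isHomogeneous B hf
    rw [mem_pointIdeal_pow_iff hB0] at hfr
    have hsum : f = ∑ e ∈ (coordEquiv B f).support,
        coeff e (coordEquiv B f) • (coordEquiv B).symm (monomial e 1) := by
      rw [← (coordEquiv B).symm_apply_apply f]
      conv_lhs => rw [(coordEquiv B f).as_sum]
      rw [map_sum, AlgEquiv.apply_symm_apply]
      refine Finset.sum_congr rfl fun e _ => ?_
      rw [← map_smul, smul_monomial, smul_eq_mul, mul_one]
    rw [hsum]
    refine Submodule.sum_mem _ fun e he => Submodule.smul_mem _ _ ?_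
    have hne := mem_support_iff.1 he
    have hre := hfr e hne
    have hdeg : e.degree = d := by
      by_contra h
      exact hne (hg.coeff_eq_zero h)
    have hmonh : ((coordEquiv B).symm (monomial e (1 : K))).IsHomogeneous d :=
      coordEquiv_symm_isHomogeneous B (isHomogeneous_monomial _ hdeg)
    by_cases hlt : r + 1 ≤ tailDeg e
    · refine ih (r + 1) (by omega) _ hmonh ?_
      rw [mem_pointIdeal_pow_iff hB0, AlgEquiv.apply_symm_apply]
      intro e' he'
      rw [coeff_monomial] at he'
      split_ifs at he' with h
      · rwa [← h]
      · exact absurd rfl he'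
    have hr' : ∑ k : Fin n, e k.succ = r := by
      change tailDeg e = r
      omega
    have he0 : e 0 = d - r := by
      have := degree_eq_add_tailDeg e
      change tailDeg e = r at hr'
      omega
    have hrd : r ≤ d := by
      have := degree_eq_add_tailDeg e
      change tailDeg e = r at hr'
      omega
    obtain ⟨F, hFh, hFx, hFD, hFq⟩ := hF (fun k => e k.succ) (by omega) (by omega)
    rw [hr'] at hFh hFq
    set Y := (coordEquiv B).symm (X 0)
    set M := ∏ k : Fin n, (coordEquiv B).symm (X k.succ) ^ e k.succ
    have hmon : (coordEquiv B).symm (monomial e (1 : K)) = Y ^ (d - r) * M := by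
      rw [monomial_eq, Finsupp.prod_fintype _ _ (by simp), Fin.prod_univ_succ, he0]
      simp [Y, M]
    have hYh : Y.IsHomogeneous 1 := coordEquiv_symm_isHomogeneous B (isHomogeneous_X _ _)
    have hMh : M.IsHomogeneous r := by
      rw [← hr']
      refine IsHomogeneous.prod _ _ _ fun k _ => ?_
      simpa using (coordEquiv_symm_isHomogeneous B (isHomogeneous_X K k.succ)).pow (e k.succ)
    have hYx : eval (p x).rep Y = 1 := by
      have h1 := eval_coordEquiv B (Pi.single 0 1) Y
      have h2 : (fun i => ∑ j, B j i * (Pi.single 0 1 : Fin (n + 1) → K) j) = (p x).rep := by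
        ext i
        simp [Pi.single_apply, ← hB0]
      rw [h2] at h1
      rw [← h1]
      simp [Y]
    have hMx : M ∈ pointIdeal (p x) ^ r := by
      rw [← hr', ← Finset.prod_pow_eq_pow_sum]
      exact Ideal.prod_mem_prod fun k _ => Ideal.pow_mem_pow
        (coordEquiv_symm_X_succ_mem hB0 (Fin.succ_ne_zero k).symm) _
    have hMq : ∀ k, M ∈ pointIdeal (p (q k)) ^ (r - e k.succ) := by
      intro k
      have h1 : r - e k.succ = ∑ l ∈ Finset.univ.erase k, e l.succ := by
        rw [← hr', ← Finset.add_sum_erase _ _ (Finset.mem_univ k)]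
        omega
      rw [h1, ← Finset.prod_pow_eq_pow_sum]
      simp only [M]
      rw [← Finset.mul_prod_erase _ _ (Finset.mem_univ k)]
      refine Ideal.mul_mem_left _ _ (Ideal.prod_mem_prod fun l hl => Ideal.pow_mem_pow
        (coordEquiv_symm_X_succ_mem (hBq k) ?_) _)
      exact fun h => (Finset.mem_erase.1 hl).1 (Fin.succ_injective _ h.symm)
    set a := eval (p x).rep F
    set G := Y ^ (d - r) - C a⁻¹ * F
    have hYdh : (Y ^ (d - r)).IsHomogeneous (d - r) := by simpa using hYh.pow (d - r)
    have hGh : G.IsHomogeneous (d - r) := hYdh.sub (hFh.C_mul _)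
    have hGx : G ∈ pointIdeal (p x) := by
      refine mem_pointIdeal_of_eval_eq_zero hB0 hGh ?_
      simp [G, hYx, a, hFx]
    have heq : Y ^ (d - r) * M = C a⁻¹ * (F * M) + M * G := by
      simp only [G]
      ring
    have hdr : d - r + r = d := by omega
    have hFM : (F * M).IsHomogeneous d := hdr ▸ hFh.mul hMh
    rw [hmon, heq]
    refine Submodule.add_mem _ (Submodule.mem_sup_left (mem_fatForms.2 ⟨hFM.C_mul _, ?_⟩)) ?_
    · intro j hj
      refine Ideal.mul_mem_left _ _ ?_
      by_cases hjq : j ∈ Set.range q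
      · obtain ⟨k, rfl⟩ := hjq
        have := Ideal.mul_mem_mul (hFq k hj) (hMq k)
        rw [← pow_add] at this
        exact Ideal.pow_le_pow_right (by omega) this
      · exact Ideal.mul_mem_right _ _ (hFD j hj hjq)
    · refine ih (r + 1) (by omega) _ ?_ ?_
      · have := hMh.mul hGh
        rwa [show r + (d - r) = d by omega] at this
      · rw [pow_succ]
        exact Ideal.mul_mem_mul hMx hGx

end GeneralPosition

section Independence

variable {n s : ℕ} {p : Fin s → Projectivization K (Fin (n + 1) → K)}

lemma exists_form_of_sum_le (hinj : Function.Injective p) (hlgp : LinGenPos (Set.range p))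
    {m : Fin s → ℕ} {d : ℕ} {k : Fin s} {D : Finset (Fin s)} (hk : k ∉ D)
    {q : Fin n → Fin s} (hq : Function.Injective q) (e : Fin n → ℕ)
    (hle : ∀ j ∈ D, m j + ∑ l, e l ≤ d)
    (hD : D.card ≤ n ∨ ((∀ l, q l ∈ D ∧ ∑ l, e l ≤ m (q l)) ∧ ∑ j ∈ D, m j + ∑ l, e l ≤ n * d)) :
    ∃ F : MvPolynomial (Fin (n + 1)) K,
      F.IsHomogeneous (d - ∑ l, e l) ∧ eval (p k).rep F ≠ 0 ∧
      (∀ j ∈ D, j ∉ Set.range q → F ∈ pointIdeal (p j) ^ m j) ∧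
      ∀ l, q l ∈ D → F ∈ pointIdeal (p (q l)) ^ (m (q l) - (∑ l, e l - e l)) := by
  classical
  set r := ∑ l, e l
  set δ : Fin s → ℕ := fun j => ∑ l, if q l = j then r - e l else 0
  have hδq : ∀ l, δ (q l) = r - e l := by
    intro l
    simp only [δ]
    rw [Finset.sum_eq_single l] <;> simp +contextual [hq.eq_iff]
  have hδ0 : ∀ j, j ∉ Set.range q → δ j = 0 := by
    intro j hj
    simp only [δ]
    refine Finset.sum_eq_zero fun l _ => if_neg fun h => hj ⟨l, h⟩
  have hw : ∑ j, (if j ∈ D then m j - δ j else 0) ≤ n * (d - r) := by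
    rw [← Finset.sum_filter, Finset.filter_mem_eq_inter, Finset.univ_inter]
    rcases hD with hD | ⟨hqD, hsum⟩
    · refine (Finset.sum_le_card_nsmul D _ (d - r) fun j hj => ?_).trans ?_
      · have := hle j hj
        omega
      · rw [smul_eq_mul]
        exact Nat.mul_le_mul_right _ hD
    · have h1 : ∑ j ∈ D, δ j + r = n * r := by
        have h2 : ∑ j ∈ D, δ j = ∑ l, (r - e l) := by
          simp only [δ]
          rw [Finset.sum_comm]
          refine Finset.sum_congr rfl fun l _ => ?_
          rw [Finset.sum_ite_eq, if_pos (hqD l).1]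
        rw [h2]
        change ∑ l, (r - e l) + ∑ l, e l = n * r
        rw [← Finset.sum_add_distrib, Finset.sum_congr rfl fun l _ => Nat.sub_add_cancel
          (Finset.single_le_sum (fun _ _ => Nat.zero_le _) (Finset.mem_univ l) : e l ≤ r)]
        rw [Finset.sum_const, Finset.card_univ, Fintype.card_fin, smul_eq_mul]
      have h3 : ∑ j ∈ D, (m j - δ j) + ∑ j ∈ D, δ j = ∑ j ∈ D, m j := by
        rw [← Finset.sum_add_distrib]
        refine Finset.sum_congr rfl fun j _ => Nat.sub_add_cancel ?_
        by_cases hj : j ∈ Set.range q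
        · obtain ⟨l, rfl⟩ := hj
          rw [hδq]
          exact (Nat.sub_le _ _).trans (hqD l).2
        · rw [hδ0 j hj]
          exact Nat.zero_le _
      rw [Nat.mul_sub]
      omega
  obtain ⟨F, hF, hFk, hFj⟩ := exists_form_of_weights hinj hlgp k (d - r)
    (fun j => if j ∈ D then m j - δ j else 0) (by simp [hk]) (by
      intro j
      split_ifs with h
      · have := hle j h
        omega
      · exact Nat.zero_le _) hw
  refine ⟨F, hF, hFk, fun j hj hjq => ?_, fun l hl => ?_⟩
  · simpa [hj, hδ0 j hjq] using hFj j
  · simpa [hl, hδq l] using hFj (q l)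

lemma exists_basis_cons (hinj : Function.Injective p) (hlgp : LinGenPos (Set.range p))
    {k : Fin s} {q : Fin n → Fin s} (hq : Function.Injective q) (hk : ∀ l, q l ≠ k) :
    ∃ B : Basis (Fin (n + 1)) K (Fin (n + 1) → K), B 0 = (p k).rep ∧
      ∀ l, B (Fin.succ l) = (p (q l)).rep := by
  obtain ⟨B, hB⟩ := exists_basis_of_linGenPos hinj hlgp (q := Fin.cons k q)
    (Fin.cons_injective_iff.2 ⟨fun ⟨l, hl⟩ => hk l hl, hq⟩)
  exact ⟨B, by simp [hB], fun l => by simp [hB]⟩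

lemma exists_avoiding_index (hs : n + 1 ≤ s) (k : Fin s) :
    ∃ q : Fin n → Fin s, Function.Injective q ∧ (∀ l, q l ≠ k) ∧
      (n ≤ k.val → ∀ l, (q l).val = l.val) := by
  refine ⟨fun l => ⟨if l.val < k.val then l.val else l.val + 1, by split_ifs <;> omega⟩, ?_, ?_, ?_⟩
  · intro a b h
    simp only [Fin.mk.injEq] at h
    ext
    split_ifs at h <;> omega
  · intro l h
    have := congrArg Fin.val h
    simp only at this
    split_ifs at this <;> omega
  · intro h l
    simp only
    rw [if_pos (by omega)]

lemma finrank_fatForms_point (hinj : Function.Injective p) (hlgp : LinGenPos (Set.range p))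
    (hs : n + 1 ≤ s) {m : Fin s → ℕ} {d : ℕ} (hpos : ∀ i, 0 < m i) (hmd : ∀ i, m i ≤ d + 1)
    (k : Fin s) : finrank K (fatForms p m d {k}) + (n + m k - 1).choose n
      = finrank K (homogeneousSubmodule (Fin (n + 1)) K d) := by
  obtain ⟨q, hq, hqk, -⟩ := exists_avoiding_index hs k
  obtain ⟨B, hB0, -⟩ := exists_basis_cons hinj hlgp hq hqk
  exact finrank_fatForms_singleton hB0 (hpos k) (hmd k)

lemma fatForms_anti {m : Fin s → ℕ} {d : ℕ} {E E' : Finset (Fin s)} (h : E ⊆ E') :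
    fatForms p m d E' ≤ fatForms p m d E := fun f hf => by
  rw [mem_fatForms] at hf ⊢
  exact ⟨hf.1, fun j hj => hf.2 j (h hj)⟩

/-- Points in linearly general position of total weight at most `n * d + 1` impose independent
conditions. -/
lemma finrank_fatForms_of_sum_le (hinj : Function.Injective p) (hlgp : LinGenPos (Set.range p))
    (hs : n + 1 ≤ s) {m : Fin s → ℕ} {d : ℕ} (hpos : ∀ i, 0 < m i) (hmd : ∀ i, m i ≤ d + 1)
    (hsort : ∀ i j : Fin s, i ≤ j → m j ≤ m i) (hpair : ∀ i j, i ≠ j → m i + m j ≤ d + 1)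
    {T : Finset (Fin s)} (hT : ∀ j : Fin s, j.val < n → j ∈ T) (hsum : ∑ j ∈ T, m j ≤ n * d + 1) :
    finrank K (fatForms p m d T) + ∑ j ∈ T, (n + m j - 1).choose n
      = finrank K (homogeneousSubmodule (Fin (n + 1)) K d) := by
  classical
  have hrank := finrank_fatForms_point hinj hlgp hs hpos hmd
  suffices h : ∀ E : Finset (Fin s), E ⊆ T →
      finrank K (fatForms p m d E) + ∑ j ∈ E, (n + m j - 1).choose n
        = finrank K (homogeneousSubmodule (Fin (n + 1)) K d) from h T subset_rfl
  intro E
  induction E using Finset.induction_on_max with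
  | empty =>
    intro _
    rw [fatForms_empty]
    simp
  | insert k E hE ih =>
    intro hET
    have hkE : k ∉ E := fun h => lt_irrefl _ (hE k h)
    refine (finrank_fatForms_insert_add hrank hkE (ih ((Finset.subset_insert _ _).trans hET))).2 ?_
    set D := T.filter (· < k)
    have hED : E ⊆ D := fun j hj =>
      Finset.mem_filter.2 ⟨hET (Finset.mem_insert_of_mem hj), hE j hj⟩
    refine le_trans ?_ (sup_le_sup_right (fatForms_anti hED) _)
    obtain ⟨q, hq, hqk, hqv⟩ := exists_avoiding_index hs k
    obtain ⟨B, hB0, hBq⟩ := exists_basis_cons hinj hlgp hq hqk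
    refine le_sup_fatForms hB0 hBq D fun e he _ => ?_
    have hkD : k ∉ D := by simp [D]
    have hDk : ∀ j ∈ D, j < k := fun j hj => (Finset.mem_filter.1 hj).2
    refine exists_form_of_sum_le hinj hlgp hkD hq e (fun j hj => ?_) ?_
    · have := hpair j k (hDk j hj).ne
      omega
    · by_cases hkn : k.val < n
      · left
        have : D ⊆ Finset.Iio k := fun j hj => Finset.mem_Iio.2 (hDk j hj)
        have := Finset.card_le_card this
        rw [Fin.card_Iio] at this
        omega
      · right
        refine ⟨fun l => ?_, ?_⟩
        · have h1 := hqv (by omega) l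
          have h2 : q l < k := by rw [Fin.lt_def]; omega
          refine ⟨Finset.mem_filter.2 ⟨hT _ (by omega), h2⟩, ?_⟩
          have := hsort _ _ h2.le
          omega
        · have h1 : insert k D ⊆ T := Finset.insert_subset (hET (Finset.mem_insert_self _ _))
            (Finset.filter_subset _ _)
          have h2 := Finset.sum_le_sum_of_subset (f := m) h1
          rw [Finset.sum_insert hkD] at h2
          omega

lemma H1Zero_of_quadric (hinj : Function.Injective p) (hlgp : LinGenPos (Set.range p))
    {d : ℕ} (hn : 2 ≤ n) (hd : 4 ≤ d) (hs : 2 * n + 3 ≤ s)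
    {m : Fin s → ℕ} (hpos : ∀ i, 0 < m i) (hsort : ∀ i j : Fin s, i ≤ j → m j ≤ m i)
    (hm1 : m ⟨0, by omega⟩ + 2 ≤ d)
    (hsum : (∑ i, m i) = n * d + 2)
    (h2n2 : m ⟨0, by omega⟩ + m ⟨2 * n + 1, by omega⟩ ≤ d)
    (h12 : m ⟨0, by omega⟩ + m ⟨1, by omega⟩ ≤ d + 1)
    {x : Fin s} (hx : 2 * n + 1 ≤ x.val) {G : MvPolynomial (Fin (n + 1)) K}
    (hG : G.IsHomogeneous 2) (hGx : eval (p x).rep G ≠ 0)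
    (hG0 : ∀ j : Fin s, j.val ≤ 2 * n → eval (p j).rep G = 0) : H1Zero p m d := by
  classical
  have hmax : ∀ i, m i ≤ m ⟨0, by omega⟩ := fun i => hsort _ _ (Fin.le_def.2 (Nat.zero_le _))
  have hmd : ∀ i, m i ≤ d + 1 := fun i => by have := hmax i; omega
  have hlt : ∀ i j, i < j → m i + m j ≤ d + 1 := by
    intro i j hij
    have h1 : m j ≤ m ⟨1, by omega⟩ := hsort _ _ (by
      rw [Fin.le_def]; rw [Fin.lt_def] at hij; simp only; omega)
    have := hmax i
    omega
  have hpair : ∀ i j, i ≠ j → m i + m j ≤ d + 1 := by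
    intro i j hij
    rcases lt_or_gt_of_ne hij with h | h
    · exact hlt i j h
    · rw [add_comm]; exact hlt j i h
  have hrank := finrank_fatForms_point hinj hlgp (by omega) hpos hmd
  set T := Finset.univ.erase x
  have hxT : x ∉ T := Finset.notMem_erase _ _
  have hins : insert x T = Finset.univ := Finset.insert_erase (Finset.mem_univ x)
  have hsumT : m x + ∑ j ∈ T, m j = n * d + 2 := by
    rw [← hsum]
    exact Finset.add_sum_erase _ _ (Finset.mem_univ x)
  have hposx := hpos x
  have hTn : ∀ j : Fin s, j.val < 2 * n + 1 → j ∈ T := fun j hj =>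
    Finset.mem_erase.2 ⟨fun h => by subst h; omega, Finset.mem_univ _⟩
  have hTfin := finrank_fatForms_of_sum_le hinj hlgp (by omega) hpos hmd hsort hpair (T := T)
    (fun j hj => hTn j (by omega)) (by omega)
  rw [H1Zero_iff_finrank, ← hins]
  refine (finrank_fatForms_insert_add hrank hxT hTfin).2 ?_
  obtain ⟨q, hq, hqx, hqv⟩ := exists_avoiding_index (n := n) (by omega) x
  obtain ⟨B, hB0, hBq⟩ := exists_basis_cons hinj hlgp hq hqx
  refine le_sup_fatForms hB0 hBq T fun e he _ => ?_
  have hqv' : ∀ l, (q l).val = l.val := hqv (by omega)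
  have hqT : ∀ l, q l ∈ T := fun l => hTn _ (by rw [hqv' l]; omega)
  have hqm : ∀ l, m x ≤ m (q l) := fun l => hsort _ _ (by rw [Fin.le_def, hqv' l]; omega)
  by_cases hr : ∑ l, e l + 2 ≤ m x
  · refine exists_form_of_sum_le hinj hlgp hxT hq e (fun j hj => ?_)
      (Or.inr ⟨fun l => ⟨hqT l, ?_⟩, ?_⟩)
    · have := hpair j x (Finset.ne_of_mem_erase hj)
      omega
    · have := hqm l
      omega
    · omega
  set Q := Finset.Iic (⟨2 * n, by omega⟩ : Fin s)
  have hQ : ∀ j, j ∈ Q ↔ j.val ≤ 2 * n := fun j => by simp [Q, Fin.le_def]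
  have hQT : Q ⊆ T := fun j hj => hTn j (by have := (hQ j).1 hj; omega)
  have hQsum : ∑ j ∈ T, (m j - if j ∈ Q then 1 else 0) + (2 * n + 1) = ∑ j ∈ T, m j := by
    have hc : ∑ j ∈ T, (if j ∈ Q then 1 else 0) = 2 * n + 1 := by
      rw [Finset.sum_ite_mem, Finset.inter_eq_right.2 hQT]
      simp [Q]
    rw [← hc, ← Finset.sum_add_distrib]
    refine Finset.sum_congr rfl fun j _ => Nat.sub_add_cancel ?_
    have := hpos j
    split_ifs <;> omega
  have hhead : ∀ a : Fin s, 2 * n + 1 ≤ a.val → (2 * n + 2) * m a ≤ n * d + 2 := by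
    intro a ha
    rw [← hsum]
    refine le_trans ?_ (Finset.sum_le_sum_of_subset (Finset.subset_univ
      (Finset.Iic (⟨2 * n + 1, by omega⟩ : Fin s))))
    have h1 := Finset.card_nsmul_le_sum (Finset.Iic (⟨2 * n + 1, by omega⟩ : Fin s)) m (m a)
      fun i hi => hsort _ _ (by
        have := Finset.mem_Iic.1 hi
        rw [Fin.le_def] at this ⊢
        simp only at this
        omega)
    simpa using h1
  have hhalf : ∀ a : Fin s, 2 * n + 1 ≤ a.val → 2 * m a < d := by
    intro a ha
    have h1 := hhead a ha
    by_contra h2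
    have h3 : (n + 1) * d ≤ (n + 1) * (2 * m a) := Nat.mul_le_mul_left _ (by omega)
    have h4 : (n + 1) * (2 * m a) = (2 * n + 2) * m a := by ring
    have h5 : (n + 1) * d = n * d + d := by ring
    omega
  obtain ⟨F, hF, hFx, hFT, hFq⟩ := exists_form_of_sum_le hinj hlgp (d := d - 2)
    (m := fun j => m j - if j ∈ Q then 1 else 0) hxT hq e (fun j hj => by
      simp only [hQ]
      have hxh := hhalf x hx
      split_ifs with h
      · have h1 := hmax j
        have h2 : m x ≤ m ⟨2 * n + 1, by omega⟩ := hsort _ _ (Fin.le_def.2 hx)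
        have := hpos j
        omega
      · have := hhalf j (by omega)
        omega)
    (Or.inr ⟨fun l => ⟨hqT l, by
      have := hqm l
      split_ifs <;> omega⟩, by
      have h5 : n * (d - 2) = n * d - 2 * n := by rw [Nat.mul_sub]; ring_nf
      have h6 : n * 4 ≤ n * d := Nat.mul_le_mul_left _ hd
      omega⟩)
  have hGQ : ∀ j, G ∈ pointIdeal (p j) ^ (if j ∈ Q then 1 else 0) := by
    intro j
    split_ifs with h
    · obtain ⟨q', hq', hqj, -⟩ := exists_avoiding_index (n := n) (by omega) j
      obtain ⟨B', hB', -⟩ := exists_basis_cons hinj hlgp hq' hqj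
      rw [pow_one]
      exact mem_pointIdeal_of_eval_eq_zero hB' hG (hG0 j ((hQ j).1 h))
    · simp
  refine ⟨F * G, ?_, ?_, fun j hj hjq => ?_, fun l hl => ?_⟩
  · have := hF.mul hG
    have hm1x := hmax x
    rwa [show d - 2 - ∑ k, e k + 2 = d - ∑ k, e k by omega] at this
  · rw [map_mul]
    exact mul_ne_zero hFx hGx
  · have := Ideal.mul_mem_mul (hFT j hj hjq) (hGQ j)
    rw [← pow_add] at this
    exact Ideal.pow_le_pow_right (by omega) this
  · have := Ideal.mul_mem_mul (hFq l hl) (hGQ (q l))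
    rw [← pow_add] at this
    exact Ideal.pow_le_pow_right (by omega) this

end Independence

section BinaryForms

/-- The functions on `K × K` given by binary forms of degree `n`. -/
def binaryForms (K : Type*) [Field K] (n : ℕ) : Submodule K (K × K → K) :=
  Submodule.span K {f | ∃ a b, a + b = n ∧ f = fun w => w.1 ^ a * w.2 ^ b}

lemma linear_mul_mem_binaryForms {n : ℕ} (α β : K) {f : K × K → K} (hf : f ∈ binaryForms K n) :
    (fun w => (α * w.1 + β * w.2) * f w) ∈ binaryForms K (n + 1) := by
  induction hf using Submodule.span_induction with
  | mem f hf =>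
    obtain ⟨a, b, hab, rfl⟩ := hf
    have h1 : (fun w : K × K => w.1 ^ (a + 1) * w.2 ^ b) ∈ binaryForms K (n + 1) :=
      Submodule.subset_span ⟨a + 1, b, by omega, rfl⟩
    have h2 : (fun w : K × K => w.1 ^ a * w.2 ^ (b + 1)) ∈ binaryForms K (n + 1) :=
      Submodule.subset_span ⟨a, b + 1, by omega, rfl⟩
    convert add_mem (Submodule.smul_mem _ α h1) (Submodule.smul_mem _ β h2) using 1
    ext w
    simp only [Pi.add_apply, Pi.smul_apply, smul_eq_mul]
    ring
  | zero => convert zero_mem (binaryForms K (n + 1)) using 1; ext w; simp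
  | add f g _ _ hf hg => convert add_mem hf hg using 1; ext w; simp [mul_add]
  | smul c f _ hf =>
    convert Submodule.smul_mem _ c hf using 1
    ext w
    simp only [Pi.smul_apply, smul_eq_mul]
    ring

lemma prod_linear_mem_binaryForms {n : ℕ} (α β : Fin n → K) :
    (fun w => ∏ k, (α k * w.1 + β k * w.2)) ∈ binaryForms K n := by
  induction n with
  | zero => exact Submodule.subset_span ⟨0, 0, rfl, by simp⟩
  | succ n ih =>
    simp only [Fin.prod_univ_succ]
    exact linear_mul_mem_binaryForms _ _ (ih _ _)

lemma exists_coeff_of_mem_binaryForms {n : ℕ} {f : K × K → K} (hf : f ∈ binaryForms K n) :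
    ∃ γ : Fin (n + 1) → K, ∀ s t, f (s, t) = ∑ j, γ j * (s ^ (n - (j : ℕ)) * t ^ (j : ℕ)) := by
  induction hf using Submodule.span_induction with
  | mem f hf =>
    obtain ⟨a, b, hab, rfl⟩ := hf
    refine ⟨Pi.single ⟨b, by omega⟩ 1, fun s t => ?_⟩
    rw [Finset.sum_eq_single ⟨b, by omega⟩]
    · simp [← hab]
    · intro j _ hj
      simp [hj]
    · simp
  | zero => exact ⟨0, by simp⟩
  | add f g _ _ hf hg =>
    obtain ⟨γ, hγ⟩ := hf
    obtain ⟨δ, hδ⟩ := hg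
    exact ⟨γ + δ, fun s t => by simp [hγ, hδ, add_mul, Finset.sum_add_distrib]⟩
  | smul c f _ hf =>
    obtain ⟨γ, hγ⟩ := hf
    exact ⟨c • γ, fun s t => by simp [hγ, Finset.mul_sum, mul_assoc]⟩

lemma det_mem_binaryForms {n : ℕ} (A B : Matrix (Fin n) (Fin n) K) :
    (fun w : K × K => (w.1 • A + w.2 • B).det) ∈ binaryForms K n := by
  have : (fun w : K × K => (w.1 • A + w.2 • B).det) = ∑ σ : Equiv.Perm (Fin n),
      ((Equiv.Perm.sign σ : ℤ) : K) •
        fun w : K × K => ∏ k, (A (σ k) k * w.1 + B (σ k) k * w.2) := by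
    ext w
    simp [Matrix.det_apply', mul_comm]
  rw [this]
  exact sum_mem fun σ _ => Submodule.smul_mem _ _ (prod_linear_mem_binaryForms _ _)

/-- The kernels of a pencil of `n × (n + 1)` matrices of constant rank `n` are parametrised by
binary forms of degree `n`. -/
lemma exists_linearMap_of_pencil {n : ℕ} (A B : Fin n → Fin (n + 1) → K)
    (hAB : ∀ w : K × K, w ≠ 0 → LinearIndependent K fun k => w.1 • A k + w.2 • B k) :
    ∃ g : (Fin (n + 1) → K) →ₗ[K] (Fin (n + 1) → K), ∀ w : K × K, w ≠ 0 →
      ∀ z : Fin (n + 1) → K, (∀ k, (w.1 • A k + w.2 • B k) ⬝ᵥ z = 0) →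
        ∃ c : K, z = c • g (fun j => w.1 ^ (n - (j : ℕ)) * w.2 ^ (j : ℕ)) := by
  set v : K × K → Fin (n + 1) → K := fun w i => (-1) ^ (i : ℕ) *
    (w.1 • Matrix.of (fun k k' => A k (i.succAbove k')) +
      w.2 • Matrix.of (fun k k' => B k (i.succAbove k'))).det
  have hv : ∀ w y, (Matrix.of (Fin.cons y fun k => w.1 • A k + w.2 • B k :
      Fin (n + 1) → Fin (n + 1) → K)).det = y ⬝ᵥ v w := by
    intro w y
    rw [Matrix.det_succ_row_zero, dotProduct]
    refine Finset.sum_congr rfl fun i _ => ?_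
    simp only [v, Matrix.of_apply, Fin.cons_zero]
    rw [mul_comm ((-1 : K) ^ (i : ℕ)) (y i), mul_assoc]
    congr 3
  choose γ hγ using fun i : Fin (n + 1) => exists_coeff_of_mem_binaryForms
    (Submodule.smul_mem _ ((-1 : K) ^ (i : ℕ)) (det_mem_binaryForms
      (Matrix.of (fun k k' => A k (i.succAbove k')))
      (Matrix.of (fun k k' => B k (i.succAbove k')))))
  refine ⟨Matrix.mulVecLin (Matrix.of γ), fun w hw z hz => ?_⟩
  have hg :
      Matrix.mulVecLin (Matrix.of γ) (fun j => w.1 ^ (n - (j : ℕ)) * w.2 ^ (j : ℕ)) = v w := by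
    ext i
    exact (hγ i w.1 w.2).symm
  rw [hg]
  have hli := hAB w hw
  obtain ⟨y, hy⟩ : ∃ y, y ∉ Submodule.span K (Set.range fun k => w.1 • A k + w.2 • B k) := by
    by_contra! h
    have h1 := finrank_span_eq_card hli
    rw [(Submodule.eq_top_iff' (p := Submodule.span K _)).2 h, finrank_top] at h1
    simp at h1
  set M : Matrix (Fin (n + 1)) (Fin (n + 1)) K :=
    Matrix.of (Fin.cons y fun k => w.1 • A k + w.2 • B k)
  have hM : IsUnit M := Matrix.linearIndependent_rows_iff_isUnit.1
    (linearIndependent_finCons.2 ⟨hli, hy⟩)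
  have hdet : y ⬝ᵥ v w ≠ 0 := by
    rw [← hv]
    exact ((Matrix.isUnit_iff_isUnit_det _).1 hM).ne_zero
  refine ⟨(y ⬝ᵥ z) / (y ⬝ᵥ v w), Matrix.mulVec_injective_of_isUnit hM ?_⟩
  rw [Matrix.mulVec_smul]
  ext i
  refine Fin.cases ?_ (fun k => ?_) i
  · change y ⬝ᵥ z = (y ⬝ᵥ z) / (y ⬝ᵥ v w) * (y ⬝ᵥ v w)
    rw [div_mul_cancel₀ _ hdet]
  · change (w.1 • A k + w.2 • B k) ⬝ᵥ z = (y ⬝ᵥ z) / (y ⬝ᵥ v w) * ((w.1 • A k + w.2 • B k) ⬝ᵥ v w)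
    have h0 : (w.1 • A k + w.2 • B k) ⬝ᵥ v w = 0 := by
      rw [← hv]
      exact Matrix.det_zero_of_row_eq (Fin.succ_ne_zero k).symm (by ext; rfl)
    rw [hz, h0, mul_zero]

end BinaryForms

section Orthogonality

lemma exists_dotProduct_equiv (K : Type*) [Field K] (N : ℕ) :
    ∃ T : (Fin N → K) ≃ₗ[K] Module.Dual K (Fin N → K), ∀ f e, T f e = f ⬝ᵥ e :=
  ⟨Module.piEquiv (Fin N) K K, fun f e => by
    simp [Module.piEquiv_apply_apply, dotProduct, mul_comm]⟩

lemma exists_orthogonal_submodule {N : ℕ} (E : Submodule K (Fin N → K)) :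
    ∃ E' : Submodule K (Fin N → K), finrank K E + finrank K E' = N ∧
      ∀ f, f ∈ E' ↔ ∀ e ∈ E, f ⬝ᵥ e = 0 := by
  obtain ⟨T, hT⟩ := exists_dotProduct_equiv K N
  refine ⟨E.dualAnnihilator.comap T.toLinearMap, ?_, fun f => ?_⟩
  · have h1 := Subspace.finrank_add_finrank_dualAnnihilator_eq E
    rw [finrank_fin_fun] at h1
    refine Eq.trans ?_ h1
    congr 1
    have := LinearEquiv.finrank_map_eq T.symm E.dualAnnihilator
    rwa [Submodule.map_equiv_eq_comap_symm] at this
  · rw [Submodule.mem_comap, Submodule.mem_dualAnnihilator]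
    simp only [LinearEquiv.coe_coe, hT]

lemma finrank_add_le_of_orthogonal {N : ℕ} {E F : Submodule K (Fin N → K)}
    (h : ∀ e ∈ E, ∀ f ∈ F, f ⬝ᵥ e = 0) : finrank K E + finrank K F ≤ N := by
  obtain ⟨E', hE', h'⟩ := exists_orthogonal_submodule E
  have := Submodule.finrank_mono (s := F) (t := E') fun f hf => (h' f).2 fun e he => h e he f hf
  omega

lemma exists_orthogonal {N : ℕ} {E : Submodule K (Fin N → K)} {r : ℕ} (h : finrank K E + r ≤ N) :
    ∃ a : Fin r → Fin N → K, LinearIndependent K a ∧ ∀ k, ∀ e ∈ E, a k ⬝ᵥ e = 0 := by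
  obtain ⟨E', hE', h'⟩ := exists_orthogonal_submodule E
  obtain ⟨a, ha⟩ := exists_linearIndependent_of_le_finrank (R := K) (M := E') (n := r) (by omega)
  exact ⟨fun k => (a k).1, ha.map' E'.subtype (Submodule.ker_subtype _),
    fun k => (h' _).1 (a k).2⟩

end Orthogonality

section Castelnuovo

variable {n s : ℕ} {p : Fin s → Projectivization K (Fin (n + 1) → K)}

lemma eval_rep_eq_zero {x : Projectivization K (Fin (n + 1) → K)}
    {f : MvPolynomial (Fin (n + 1)) K} (hf : f ∈ pointIdeal x) : eval x.rep f = 0 := by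
  have h : pointIdeal x ≤ RingHom.ker (eval x.rep) := by
    refine Ideal.span_le.2 ?_
    rintro _ ⟨c, hc, rfl⟩
    simpa [RingHom.mem_ker] using hc
  exact RingHom.mem_ker.1 (h hf)

/-- Evaluation of degree `d` forms at representatives of points, as a linear map. -/
noncomputable def evalForms {N : ℕ} (d : ℕ) (v : Fin N → Fin (n + 1) → K) :
    homogeneousSubmodule (Fin (n + 1)) K d →ₗ[K] Fin N → K :=
  (LinearMap.pi fun i => (aeval (v i)).toLinearMap) ∘ₗ
    (homogeneousSubmodule (Fin (n + 1)) K d).subtype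

lemma evalForms_apply {N d : ℕ} (v : Fin N → Fin (n + 1) → K)
    (f : homogeneousSubmodule (Fin (n + 1)) K d) (i : Fin N) :
    evalForms d v f i = eval (v i) f.1 := by
  simp [evalForms, aeval_eq_eval]

/-- If all degree `d` forms vanishing at the first `M` points vanish at all the points, then the
points impose at most `M` conditions on degree `d` forms. -/
lemma finrank_range_evalForms_le {N M : ℕ} (hM : M ≤ N) (d : ℕ) (v : Fin N → Fin (n + 1) → K)
    (hQ : ∀ G : MvPolynomial (Fin (n + 1)) K, G.IsHomogeneous d →
      (∀ i : Fin N, i.val < M → eval (v i) G = 0) → ∀ i, eval (v i) G = 0) :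
    finrank K (LinearMap.range (evalForms d v)) ≤ M := by
  have h : Function.Injective ((LinearMap.funLeft K K (Fin.castLE hM)).domRestrict
      (LinearMap.range (evalForms d v))) := by
    rw [injective_iff_map_eq_zero]
    rintro ⟨_, G, rfl⟩ h0
    ext i
    simp only [ZeroMemClass.coe_zero, Pi.zero_apply, evalForms_apply]
    refine hQ G.1 G.2 (fun i hi => ?_) i
    have := congrFun h0 ⟨i, hi⟩
    rw [← evalForms_apply]
    exact this
  simpa using LinearMap.finrank_le_finrank_of_injective h

/-- A linear relation among the values of quadrics at `2 * n + 3` points in linearly general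
position has at most one zero coefficient. -/
lemma eq_zero_of_quadric_relation (hinj : Function.Injective p)
    (hlgp : LinGenPos (Set.range p)) (hs : 2 * n + 3 ≤ s) {c : Fin (2 * n + 3) → K}
    (hc : ∀ G : MvPolynomial (Fin (n + 1)) K, G.IsHomogeneous 2 →
      ∑ i, c i * eval (p (Fin.castLE hs i)).rep G = 0)
    {i₁ i₂ : Fin (2 * n + 3)} (h12 : i₁ ≠ i₂) (h1 : c i₁ = 0) (h2 : c i₂ = 0) : c = 0 := by
  classical
  ext i
  simp only [Pi.zero_apply]
  by_contra hi
  have hi1 : i₁ ≠ i := fun h => hi (h ▸ h1)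
  have hi2 : i₂ ≠ i := fun h => hi (h ▸ h2)
  set A : Finset (Fin (2 * n + 3)) := ((Finset.univ.erase i).erase i₁).erase i₂
  have hA : A.card = 2 * n := by
    rw [Finset.card_erase_of_mem (by simp [h12.symm, hi2]),
      Finset.card_erase_of_mem (by simp [hi1]), Finset.card_erase_of_mem (Finset.mem_univ _)]
    simp
  set B := A.map (Fin.castLEEmb hs)
  have hB : ∀ j, Fin.castLE hs j ∈ B ↔ j ∈ A := fun j => Finset.mem_map' (Fin.castLEEmb hs)
  obtain ⟨F, hF, hFi, hFj⟩ := exists_form_of_weights hinj hlgp (Fin.castLE hs i) 2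
    (fun j => if j ∈ B then 1 else 0) (if_neg (by rw [hB]; simp [A]))
    (fun j => by split_ifs <;> omega) (by
      rw [Finset.sum_ite_mem, Finset.univ_inter, Finset.sum_const, Finset.card_map, hA]
      simp [mul_comm])
  have h := hc F hF
  rw [Finset.sum_eq_single i] at h
  · exact hi ((mul_eq_zero.1 h).resolve_right hFi)
  · intro j _ hj
    by_cases hj1 : j = i₁
    · rw [hj1, h1, zero_mul]
    by_cases hj2 : j = i₂
    · rw [hj2, h2, zero_mul]
    have hjA : j ∈ A := by simp [A, hj, hj1, hj2]
    have := hFj (Fin.castLE hs j)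
    rw [if_pos ((hB j).2 hjA), pow_one] at this
    rw [eval_rep_eq_zero this, mul_zero]
  · simp

/-- A linear form vanishing at `n + 1` of the points is zero. -/
lemma eq_zero_of_vanishing_castLE (hinj : Function.Injective p)
    (hlgp : LinGenPos (Set.range p)) {N : ℕ} (hN : N ≤ s) {A : Finset (Fin N)}
    (hA : n + 1 ≤ A.card) {c : Fin (n + 1) → K}
    (hc : ∀ i ∈ A, c ⬝ᵥ (p (Fin.castLE hN i)).rep = 0) : c = 0 := by
  refine eq_zero_of_vanishing hinj hlgp (A := A.map (Fin.castLEEmb hN)) (by simpa using hA) ?_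
  intro j hj
  obtain ⟨i, hi, rfl⟩ := Finset.mem_map.1 hj
  exact hc i hi

/-- Castelnuovo's pencil of linear syzygies. -/
lemma exists_pencil (hinj : Function.Injective p) (hlgp : LinGenPos (Set.range p))
    (hs : 2 * n + 3 ≤ s)
    (hQ : ∀ G : MvPolynomial (Fin (n + 1)) K, G.IsHomogeneous 2 →
      (∀ j : Fin s, j.val ≤ 2 * n → eval (p j).rep G = 0) → ∀ j, eval (p j).rep G = 0) :
    ∃ A B : Fin n → Fin (n + 1) → K,
      (∀ w : K × K, w ≠ 0 → LinearIndependent K fun k => w.1 • A k + w.2 • B k) ∧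
      ∀ j : Fin s, j.val ≤ 2 * n → ∃ w : K × K, w ≠ 0 ∧
        ∀ k, (w.1 • A k + w.2 • B k) ⬝ᵥ (p j).rep = 0 := by
  classical
  set v : Fin (2 * n + 3) → Fin (n + 1) → K := fun i => (p (Fin.castLE hs i)).rep
  obtain ⟨c, hcli, hc⟩ := exists_orthogonal (r := 2)
    (E := LinearMap.range (evalForms 2 v)) (by
      have := finrank_range_evalForms_le (M := 2 * n + 1) (by omega) 2 v fun G hG h0 i =>
        hQ G hG (fun j hj => h0 ⟨j, by omega⟩ (by simp only; omega)) _
      omega)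
  have hcG : ∀ k, ∀ G : MvPolynomial (Fin (n + 1)) K, G.IsHomogeneous 2 →
      ∑ i, c k i * eval (v i) G = 0 := by
    intro k G hG
    have := hc k _ ⟨⟨G, hG⟩, rfl⟩
    simpa only [dotProduct, evalForms_apply] using this
  have hcomb : ∀ w : K × K, w ≠ 0 → ∀ i₁ i₂, i₁ ≠ i₂ →
      w.1 * c 0 i₁ + w.2 * c 1 i₁ = 0 → w.1 * c 0 i₂ + w.2 * c 1 i₂ ≠ 0 := by
    intro w hw i₁ i₂ h12 h1 h2
    have h := eq_zero_of_quadric_relation hinj hlgp hs (c := w.1 • c 0 + w.2 • c 1)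
      (fun G hG => by
        have h := congrArg₂ (w.1 * · + w.2 * ·) (hcG 0 G hG) (hcG 1 G hG)
        simp only [mul_zero, add_zero] at h
        rw [← h, Finset.mul_sum, Finset.mul_sum, ← Finset.sum_add_distrib]
        refine Finset.sum_congr rfl fun i _ => ?_
        simp only [Pi.add_apply, Pi.smul_apply, smul_eq_mul, v]
        ring) h12 (by simpa using h1) (by simpa using h2)
    have h3 := Fintype.linearIndependent_iff.1 hcli ![w.1, w.2] (by simpa using h)
    exact hw (Prod.ext (h3 0) (h3 1))
  set Ψ : ((Fin (n + 1) → K) × (Fin (n + 1) → K)) →ₗ[K] (Fin (2 * n + 3) → K) :=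
    { toFun := fun L i => c 0 i * (L.1 ⬝ᵥ v i) + c 1 i * (L.2 ⬝ᵥ v i)
      map_add' := fun L L' => by
        ext i
        simp only [Prod.fst_add, Prod.snd_add, add_dotProduct, Pi.add_apply]
        ring
      map_smul' := fun r L => by
        ext i
        simp only [Prod.smul_fst, Prod.smul_snd, smul_dotProduct, Pi.smul_apply, smul_eq_mul,
          RingHom.id_apply]
        ring }
  set Λ : (Fin (n + 1) → K) →ₗ[K] (Fin (2 * n + 3) → K) :=
    { toFun := fun h i => h ⬝ᵥ v i
      map_add' := fun L L' => by ext i; simp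
      map_smul' := fun r L => by ext i; simp }
  have hΛ : finrank K (LinearMap.range Λ) = n + 1 := by
    rw [LinearMap.finrank_range_of_inj, finrank_fin_fun]
    rw [injective_iff_map_eq_zero]
    intro h h0
    exact eq_zero_of_vanishing_castLE hinj hlgp hs (A := Finset.univ) (by simp; omega)
      fun i _ => congrFun h0 i
  have hle := finrank_add_le_of_orthogonal (E := LinearMap.range Λ) (F := LinearMap.range Ψ) (by
    rintro _ ⟨h, rfl⟩ _ ⟨L, rfl⟩
    have h0 := hcG 0 (linForm L.1 * linForm h)
      ((linForm_isHomogeneous _).mul (linForm_isHomogeneous _))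
    have h1 := hcG 1 (linForm L.2 * linForm h)
      ((linForm_isHomogeneous _).mul (linForm_isHomogeneous _))
    have h2 := congrArg₂ (· + ·) h0 h1
    simp only [add_zero, map_mul, eval_linForm] at h2
    rw [← h2, ← Finset.sum_add_distrib, dotProduct]
    refine Finset.sum_congr rfl fun i _ => ?_
    change (c 0 i * (L.1 ⬝ᵥ v i) + c 1 i * (L.2 ⬝ᵥ v i)) * (h ⬝ᵥ v i) = _
    simp only [dotProduct]
    ring)
  have hker : n ≤ finrank K (LinearMap.ker Ψ) := by
    have := LinearMap.finrank_range_add_finrank_ker Ψ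
    rw [finrank_prod, finrank_fin_fun] at this
    omega
  obtain ⟨L, hL⟩ := exists_linearIndependent_of_le_finrank (R := K) hker
  have hL' : LinearIndependent K fun k => (L k).1 :=
    hL.map' (LinearMap.ker Ψ).subtype (Submodule.ker_subtype _)
  have hrel : ∀ M ∈ LinearMap.ker Ψ, ∀ i, c 0 i * (M.1 ⬝ᵥ v i) + c 1 i * (M.2 ⬝ᵥ v i) = 0 :=
    fun M hM i => congrFun (LinearMap.mem_ker.1 hM) i
  refine ⟨fun k => (L k).1.1, fun k => (L k).1.2, fun w hw => ?_, fun j hj => ?_⟩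
  · rw [Fintype.linearIndependent_iff] at hL' ⊢
    intro a ha
    refine hL' a ?_
    set M := ∑ k, a k • (L k).1
    have hM : M ∈ LinearMap.ker Ψ := sum_mem fun k _ => Submodule.smul_mem _ _ (L k).2
    have hwM : w.1 • M.1 + w.2 • M.2 = 0 := by
      rw [← ha]
      simp only [M, Prod.fst_sum, Prod.snd_sum, Finset.smul_sum, Prod.smul_fst, Prod.smul_snd,
        ← Finset.sum_add_distrib, smul_add]
      refine Finset.sum_congr rfl fun k _ => ?_
      rw [smul_comm w.1, smul_comm w.2]
    set A := Finset.univ.filter fun i => w.2 * c 0 i + (-w.1) * c 1 i ≠ 0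
    have hA : n + 1 ≤ A.card := by
      have h1 := Finset.card_add_card_compl A
      have h2 : Aᶜ.card ≤ 1 := by
        rw [Finset.card_le_one]
        intro i hi i' hi'
        by_contra hne
        simp only [A, Finset.mem_compl, ne_eq, not_not, Finset.mem_filter, Finset.mem_univ,
          true_and] at hi hi'
        refine hcomb (w.2, -w.1) (fun h => hw ?_) i i' hne hi hi'
        simp only [Prod.mk_eq_zero, neg_eq_zero] at h
        exact Prod.ext h.2 h.1
      rw [Fintype.card_fin] at h1
      omega
    have hv : ∀ i ∈ A, M.1 ⬝ᵥ v i = 0 ∧ M.2 ⬝ᵥ v i = 0 := by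
      intro i hi
      have h1 := hrel M hM i
      have h2 := congrArg (· ⬝ᵥ v i) hwM
      simp only [add_dotProduct, smul_dotProduct, smul_eq_mul, zero_dotProduct] at h2
      have h3 : w.2 * c 0 i + (-w.1) * c 1 i ≠ 0 := (Finset.mem_filter.1 hi).2
      constructor
      · refine (mul_eq_zero.1 ?_).resolve_left h3
        linear_combination w.2 * h1 - c 1 i * h2
      · refine (mul_eq_zero.1 ?_).resolve_left h3
        linear_combination c 0 i * h2 - w.1 * h1
    exact Prod.ext (eq_zero_of_vanishing_castLE hinj hlgp hs hA fun i hi => (hv i hi).1)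
      (eq_zero_of_vanishing_castLE hinj hlgp hs hA fun i hi => (hv i hi).2)
  · set i : Fin (2 * n + 3) := ⟨j, by omega⟩
    refine ⟨(c 0 i, c 1 i), fun h => ?_, fun k => ?_⟩
    · obtain ⟨i', hi'⟩ := exists_ne i
      simp only [Prod.mk_eq_zero] at h
      by_cases h0 : c 0 i' = 0
      · exact hcomb (1, 0) (by simp) i i' hi'.symm (by simp [h.1]) (by simp [h0])
      · refine hcomb (c 1 i', -c 0 i') (by simp [h0]) i i' hi'.symm (by simp [h.1, h.2]) ?_
        simp only
        ring
    · have := hrel _ (L k).2 i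
      simp only [add_dotProduct, smul_dotProduct, smul_eq_mul]
      exact this

/-- **Castelnuovo's lemma**. -/
theorem castelnuovo (hinj : Function.Injective p) (hlgp : LinGenPos (Set.range p))
    (hs : 2 * n + 3 ≤ s)
    (hQ : ∀ G : MvPolynomial (Fin (n + 1)) K, G.IsHomogeneous 2 →
      (∀ j : Fin s, j.val ≤ 2 * n → eval (p j).rep G = 0) → ∀ j, eval (p j).rep G = 0) :
    ∃ C, IsRNC n n C ∧ Set.range p ⊆ C := by
  obtain ⟨A, B, hAB, hker⟩ := exists_pencil hinj hlgp hs hQ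
  obtain ⟨g, hg⟩ := exists_linearMap_of_pencil A B hAB
  have hmem : ∀ j, ∃ w : K × K, w ≠ 0 ∧ ∃ c : K,
      (p j).rep = c • g (fun j => w.1 ^ (n - (j : ℕ)) * w.2 ^ (j : ℕ)) := by
    intro j
    have hminor : ∀ k l, (A k ⬝ᵥ (p j).rep) * (B l ⬝ᵥ (p j).rep) =
        (A l ⬝ᵥ (p j).rep) * (B k ⬝ᵥ (p j).rep) := by
      intro k l
      have h := hQ (linForm (A k) * linForm (B l) - linForm (A l) * linForm (B k))
        (((linForm_isHomogeneous _).mul (linForm_isHomogeneous _)).sub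
          ((linForm_isHomogeneous _).mul (linForm_isHomogeneous _))) (fun i hi => by
          obtain ⟨w, hw, hwk⟩ := hker i hi
          have h1 := hwk k
          have h2 := hwk l
          simp only [add_dotProduct, smul_dotProduct, smul_eq_mul] at h1 h2
          simp only [map_sub, map_mul, eval_linForm]
          change (A k ⬝ᵥ (p i).rep) * (B l ⬝ᵥ (p i).rep) -
            (A l ⬝ᵥ (p i).rep) * (B k ⬝ᵥ (p i).rep) = 0
          by_cases h0 : w.1 = 0
          · have h3 : w.2 ≠ 0 := fun h => hw (Prod.ext h0 h)
            refine (mul_eq_zero.1 ?_).resolve_left h3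
            linear_combination (A k ⬝ᵥ (p i).rep) * h2 - (A l ⬝ᵥ (p i).rep) * h1
          · refine (mul_eq_zero.1 ?_).resolve_left h0
            linear_combination (B l ⬝ᵥ (p i).rep) * h1 - (B k ⬝ᵥ (p i).rep) * h2) j
      simp only [map_sub, map_mul, eval_linForm] at h
      exact sub_eq_zero.1 h
    have hw : ∃ w : K × K, w ≠ 0 ∧ ∀ k, (w.1 • A k + w.2 • B k) ⬝ᵥ (p j).rep = 0 := by
      simp only [add_dotProduct, smul_dotProduct, smul_eq_mul]
      by_cases h : ∃ l, A l ⬝ᵥ (p j).rep ≠ 0 ∨ B l ⬝ᵥ (p j).rep ≠ 0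
      · obtain ⟨l, hl⟩ := h
        refine ⟨(B l ⬝ᵥ (p j).rep, -(A l ⬝ᵥ (p j).rep)), fun h => ?_, fun k => ?_⟩
        · simp only [Prod.mk_eq_zero, neg_eq_zero] at h
          exact hl.elim (fun h' => h' h.2) fun h' => h' h.1
        · linear_combination hminor k l
      · push Not at h
        exact ⟨(1, 0), by simp, fun k => by simp [(h k).1]⟩
    obtain ⟨w, hw0, hwk⟩ := hw
    exact ⟨w, hw0, hg w hw0 _ hwk⟩
  have hsurj : Function.Surjective g := by
    rw [← LinearMap.range_eq_top, eq_top_iff,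
      ← span_rep_eq_top hinj hlgp (A := Finset.univ) (by simp; omega), Submodule.span_le]
    rintro _ ⟨j, -, rfl⟩
    obtain ⟨w, -, c, h⟩ := hmem j
    simp only [h]
    exact Submodule.smul_mem _ _ ⟨_, rfl⟩
  refine ⟨_, ⟨g, LinearMap.injective_iff_surjective.2 hsurj, rfl⟩, ?_⟩
  rintro _ ⟨j, rfl⟩
  obtain ⟨w, hw, c, h⟩ := hmem j
  have hne := (p j).rep_nonzero
  have hc : c ≠ 0 := fun h0 => hne (by rw [h, h0, zero_smul])
  refine ⟨w.1, w.2, ?_, fun h0 => hne (by rw [h, h0, smul_zero]), ?_⟩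
  · by_contra! h0
    exact hw (Prod.ext h0.1 h0.2)
  · conv_lhs => rw [← (p j).mk_rep]
    rw [Projectivization.mk_eq_mk_iff]
    exact ⟨Units.mk0 c hc, h.symm⟩

end Castelnuovo

section RationalNormalCurve

variable {n s : ℕ} {p : Fin s → Projectivization K (Fin (n + 1) → K)}

lemma exists_parameters [Infinite K] (hinj : Function.Injective p)
    {g : (Fin (n + 1) → K) →ₗ[K] (Fin (n + 1) → K)}
    (hp : ∀ j, ∃ a b : K, (a ≠ 0 ∨ b ≠ 0) ∧
      ∃ h : g (fun l => a ^ (n - (l : ℕ)) * b ^ (l : ℕ)) ≠ 0,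
        p j = Projectivization.mk K (g (fun l => a ^ (n - (l : ℕ)) * b ^ (l : ℕ))) h) :
    ∃ (z : K) (u : Fin s → K), Function.Injective u ∧ ∀ j, ∃ c : K, c ≠ 0 ∧
      (p j).rep = c • g (fun l => u j ^ (n - (l : ℕ)) * (1 + z * u j) ^ (l : ℕ)) := by
  classical
  choose a b hab h0 hp using hp
  obtain ⟨z, hz⟩ := Infinite.exists_notMem_finset (Finset.univ.image fun i => b i / a i)
  have hμ : ∀ j, b j - z * a j ≠ 0 := by
    intro j h
    by_cases ha : a j = 0
    · rw [ha, mul_zero, sub_zero] at h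
      exact (hab j).elim (fun h' => h' ha) fun h' => h' h
    · refine hz (Finset.mem_image.2 ⟨j, Finset.mem_univ _, ?_⟩)
      rw [div_eq_iff ha]
      exact sub_eq_zero.1 h
  set u : Fin s → K := fun j => a j / (b j - z * a j)
  have hg : ∀ j, g (fun l => a j ^ (n - (l : ℕ)) * b j ^ (l : ℕ)) = (b j - z * a j) ^ n •
      g (fun l => u j ^ (n - (l : ℕ)) * (1 + z * u j) ^ (l : ℕ)) := by
    intro j
    rw [← map_smul]
    congr 1
    ext l
    have h1 : a j = (b j - z * a j) * u j := by
      simp only [u]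
      rw [mul_div_cancel₀ _ (hμ j)]
    have h2 : b j = (b j - z * a j) * (1 + z * u j) := by
      linear_combination z * h1
    have hl : (b j - z * a j) ^ n = (b j - z * a j) ^ (n - l.val) * (b j - z * a j) ^ l.val := by
      rw [← pow_add, Nat.sub_add_cancel (Nat.le_of_lt_succ l.2)]
    simp only [Pi.smul_apply, smul_eq_mul]
    generalize b j - z * a j = μ at h1 h2 hl ⊢
    rw [h1, h2, mul_pow, mul_pow, hl]
    ring
  have hpj : ∀ j, ∃ c : K, c ≠ 0 ∧
      (p j).rep = c • g (fun l => u j ^ (n - (l : ℕ)) * (1 + z * u j) ^ (l : ℕ)) := by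
    intro j
    have h1 := (p j).mk_rep.trans (hp j)
    rw [Projectivization.mk_eq_mk_iff] at h1
    obtain ⟨c, hc⟩ := h1
    refine ⟨c * (b j - z * a j) ^ n, mul_ne_zero c.ne_zero (pow_ne_zero _ (hμ j)), ?_⟩
    rw [← hc, hg, mul_smul]
    rfl
  refine ⟨z, u, fun i j hij => hinj ?_, hpj⟩
  obtain ⟨c, hc, h⟩ := hpj i
  obtain ⟨c', hc', h'⟩ := hpj j
  rw [← (p i).mk_rep, ← (p j).mk_rep, Projectivization.mk_eq_mk_iff]
  refine ⟨Units.mk0 (c / c') (div_ne_zero hc hc'), ?_⟩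
  rw [h', h, hij]
  rw [Units.smul_def, Units.val_mk0, smul_smul, div_mul_cancel₀ _ hc']

/-- An affine polynomial parametrisation of a rational normal curve: the coordinates have degree
at most `n`, and prescribed linear forms restrict to `1` and to `X - u`. -/
lemma exists_polynomial_parametrization [Infinite K] (hn : 1 ≤ n) (z : K)
    {g : (Fin (n + 1) → K) →ₗ[K] (Fin (n + 1) → K)} (hg : Function.Injective g) :
    ∃ γ : Fin (n + 1) → Polynomial K, (∀ i, (γ i).natDegree ≤ n) ∧
      (∀ y i, (γ i).eval y = g (fun l => y ^ (n - (l : ℕ)) * (1 + z * y) ^ (l : ℕ)) i) ∧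
      (∃ c : Fin (n + 1) → K, aeval γ (linForm c) = 1) ∧
      ∀ u : K, ∃ c : Fin (n + 1) → K, aeval γ (linForm c) = Polynomial.X - Polynomial.C u := by
  set γ : Fin (n + 1) → Polynomial K := fun i => ∑ l : Fin (n + 1),
    Polynomial.C (LinearMap.toMatrix' g i l) *
      (Polynomial.X ^ (n - (l : ℕ)) * (1 + Polynomial.C z * Polynomial.X) ^ (l : ℕ))
  have hev : ∀ y i, (γ i).eval y =
      g (fun l => y ^ (n - (l : ℕ)) * (1 + z * y) ^ (l : ℕ)) i := by
    intro y i
    rw [← LinearMap.toMatrix'_mulVec g]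
    simp [γ, Polynomial.eval_finsetSum, Matrix.mulVec, dotProduct]
  have hlift : ∀ f ∈ binaryForms K n, ∀ q : Polynomial K, (∀ y, q.eval y = f (y, 1 + z * y)) →
      ∃ c : Fin (n + 1) → K, aeval γ (linForm c) = q := by
    intro f hf q hq
    obtain ⟨δ, hδ⟩ := exists_coeff_of_mem_binaryForms hf
    have hunit : IsUnit (LinearMap.toMatrix' g) :=
      Matrix.mulVec_injective_iff_isUnit.1 (by
        intro x y h
        simpa [LinearMap.toMatrix'_mulVec, hg.eq_iff] using h)
    refine ⟨Matrix.vecMul δ (LinearMap.toMatrix' g)⁻¹, Polynomial.funext fun y => ?_⟩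
    rw [hq, hδ]
    have h1 : ∀ c : Fin (n + 1) → K, (aeval γ (linForm c)).eval y =
        c ⬝ᵥ g (fun l => y ^ (n - (l : ℕ)) * (1 + z * y) ^ (l : ℕ)) := by
      intro c
      simp [linForm, Polynomial.eval_finsetSum, hev, dotProduct]
    rw [h1, ← LinearMap.toMatrix'_mulVec g, Matrix.dotProduct_mulVec, Matrix.vecMul_vecMul,
      Matrix.nonsing_inv_mul _ ((Matrix.isUnit_iff_isUnit_det _).1 hunit), Matrix.vecMul_one]
    rfl
  refine ⟨γ, fun i => ?_, hev, ?_, fun u => ?_⟩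
  · refine Polynomial.natDegree_sum_le_of_forall_le _ _ fun l _ => ?_
    refine (Polynomial.natDegree_mul_le_of_le (m := 0) (by simp)
      (Polynomial.natDegree_mul_le_of_le
        (Polynomial.natDegree_pow_le_of_le (m := 1) (n - (l : ℕ)) (by simp))
        (Polynomial.natDegree_pow_le_of_le (m := 1) (l : ℕ) ?_))).trans (by omega)
    compute_degree
  · refine hlift _ (prod_linear_mem_binaryForms (fun _ => -z) fun _ => 1) 1 fun y => ?_
    simp
  · obtain ⟨n, rfl⟩ : ∃ k, n = k + 1 := ⟨n - 1, by omega⟩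
    refine hlift _ (linear_mul_mem_binaryForms (1 + u * z) (-u)
      (prod_linear_mem_binaryForms (fun _ : Fin n => -z) fun _ => 1)) _ fun y => ?_
    simp only [Polynomial.eval_sub, Polynomial.eval_X, Polynomial.eval_C]
    rw [Finset.prod_eq_one fun _ _ => by ring]
    ring

lemma pow_dvd_aeval {γ : Fin (n + 1) → Polynomial K} {u c : K} (hc : c ≠ 0)
    {x : Projectivization K (Fin (n + 1) → K)} (hx : ∀ i, x.rep i = c * (γ i).eval u)
    {k : ℕ} {f : MvPolynomial (Fin (n + 1)) K} (hf : f ∈ pointIdeal x ^ k) :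
    (Polynomial.X - Polynomial.C u) ^ k ∣ aeval γ f := by
  have h : (pointIdeal x).map (aeval γ) ≤ Ideal.span {Polynomial.X - Polynomial.C u} := by
    rw [pointIdeal, Ideal.map_span, Ideal.span_le]
    rintro _ ⟨_, ⟨e, he, rfl⟩, rfl⟩
    rw [SetLike.mem_coe, Ideal.mem_span_singleton, Polynomial.dvd_iff_isRoot]
    refine (mul_eq_zero.1 (Eq.trans ?_ he)).resolve_left hc
    simp only [map_sum, map_mul, aeval_X, Polynomial.eval_finsetSum, Polynomial.eval_mul, hx,
      Finset.mul_sum, MvPolynomial.aeval_C, Polynomial.algebraMap_eq, Polynomial.eval_C]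
    exact Finset.sum_congr rfl fun i _ => by ring
  rw [← Ideal.mem_span_singleton, ← Ideal.span_singleton_pow]
  refine Ideal.pow_right_mono h k ?_
  rw [← Ideal.map_pow]
  exact Ideal.mem_map_of_mem _ hf

/-- Fat points of total degree `n * d + 2` on a rational normal curve do not impose independent
conditions on forms of degree `d`. -/
lemma not_H1Zero_of_subset_rnc [Infinite K] (hinj : Function.Injective p)
    (hlgp : LinGenPos (Set.range p)) (hn : 1 ≤ n) (hs : n + 1 ≤ s) {m : Fin s → ℕ} {d : ℕ}
    (hpos : ∀ i, 0 < m i) (hmd : ∀ i, m i ≤ d + 1) (hsum : ∑ i, m i = n * d + 2)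
    {C : Set (Projectivization K (Fin (n + 1) → K))} (hC : IsRNC n n C)
    (hp : Set.range p ⊆ C) : ¬ H1Zero p m d := by
  classical
  intro hH
  obtain ⟨g, hg, rfl⟩ := hC
  obtain ⟨z, u, hu, hrep⟩ := exists_parameters hinj fun j => hp ⟨j, rfl⟩
  obtain ⟨γ, hdeg, hev, ⟨c₁, hc₁⟩, hX⟩ := exists_polynomial_parametrization hn z hg
  have hdvd : ∀ (j : Fin s) (k : ℕ) (f : MvPolynomial (Fin (n + 1)) K),
      f ∈ pointIdeal (p j) ^ k → (Polynomial.X - Polynomial.C (u j)) ^ k ∣ aeval γ f := by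
    intro j k f hf
    obtain ⟨c, hc, h⟩ := hrep j
    exact pow_dvd_aeval hc (fun i => by rw [h, hev]; rfl) hf
  set x : Fin s := ⟨0, by omega⟩
  obtain ⟨c₂, hc₂⟩ := hX (u x)
  set E := Finset.univ.erase x
  have hxE : x ∉ E := Finset.notMem_erase _ _
  have hins : insert x E = Finset.univ := Finset.insert_erase (Finset.mem_univ x)
  have hsup := sup_fatForms_of_finrank_eq (finrank_fatForms_point hinj hlgp hs hpos hmd) hxE (by
    rw [hins]
    exact H1Zero_iff_finrank.1 hH)
  have hposx := hpos x
  have hmdx := hmd x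
  have hG : (linForm c₂ ^ (m x - 1) * linForm c₁ ^ (d + 1 - m x)).IsHomogeneous d := by
    have := ((linForm_isHomogeneous c₂).pow (m x - 1)).mul
      ((linForm_isHomogeneous c₁).pow (d + 1 - m x))
    rwa [show 1 * (m x - 1) + 1 * (d + 1 - m x) = d by omega] at this
  obtain ⟨A, hA, B, hB, hAB⟩ := Submodule.mem_sup.1 (hsup hG)
  rw [mem_fatForms] at hA hB
  have hpull := congrArg (aeval γ) hAB
  rw [map_add, map_mul, map_pow, map_pow, hc₁, hc₂, one_pow, mul_one] at hpull
  have hBx := hdvd x _ B (hB.2 x (Finset.mem_singleton_self x))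
  have hAx : (Polynomial.X - Polynomial.C (u x)) ^ (m x - 1) ∣ aeval γ A := by
    rw [eq_sub_of_add_eq hpull]
    exact dvd_sub dvd_rfl ((pow_dvd_pow _ (by omega)).trans hBx)
  have hcop : Pairwise (Function.onFun IsCoprime fun j => Polynomial.X - Polynomial.C (u j)) :=
    Polynomial.pairwise_coprime_X_sub_C hu
  have hAE : ∏ j ∈ E, (Polynomial.X - Polynomial.C (u j)) ^ m j ∣ aeval γ A :=
    Finset.prod_dvd_of_coprime (fun i _ j _ hij => (hcop hij).pow)
      fun j hj => hdvd j _ A (hA.2 j hj)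
  have hAll : (Polynomial.X - Polynomial.C (u x)) ^ (m x - 1) *
      ∏ j ∈ E, (Polynomial.X - Polynomial.C (u j)) ^ m j ∣ aeval γ A :=
    IsCoprime.mul_dvd (IsCoprime.prod_right fun j hj =>
    ((hcop (Finset.ne_of_mem_erase hj).symm).pow : IsCoprime
      ((Polynomial.X - Polynomial.C (u x)) ^ (m x - 1))
      ((Polynomial.X - Polynomial.C (u j)) ^ m j))) hAx hAE
  have hA0 : aeval γ A = 0 := by
    refine Polynomial.eq_zero_of_dvd_of_natDegree_lt hAll ?_
    have h1 := MvPolynomial.aeval_natDegree_le A hA.1.totalDegree_le γ hdeg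
    have h2 : ((Polynomial.X - Polynomial.C (u x)) ^ (m x - 1) *
        ∏ j ∈ E, (Polynomial.X - Polynomial.C (u j)) ^ m j).natDegree =
        (m x - 1) + ∑ j ∈ E, m j := by
      have hmon : (∏ j ∈ E, (Polynomial.X - Polynomial.C (u j)) ^ m j).Monic :=
        Polynomial.monic_prod_of_monic _ _ fun j _ => (Polynomial.monic_X_sub_C _).pow _
      rw [((Polynomial.monic_X_sub_C _).pow _).natDegree_mul hmon,
        (Polynomial.monic_X_sub_C _).natDegree_pow, Polynomial.natDegree_prod_of_monic _ _
          fun j _ => (Polynomial.monic_X_sub_C _).pow _]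
      simp [(Polynomial.monic_X_sub_C _).natDegree_pow]
    have h3 := Finset.add_sum_erase Finset.univ m (Finset.mem_univ x)
    have h4 : d * n = n * d := mul_comm _ _
    have h5 : m x + ∑ j ∈ E, m j = n * d + 2 := h3.trans hsum
    omega
  rw [hA0, zero_add] at hpull
  rw [hpull] at hBx
  have := Polynomial.natDegree_le_of_dvd hBx (pow_ne_zero _ (Polynomial.X_sub_C_ne_zero _))
  simp only [(Polynomial.monic_X_sub_C _).natDegree_pow, Polynomial.natDegree_X_sub_C] at this
  omega

end RationalNormalCurve

/-- **Theorem `cc1`.**  Fix `n ≥ 2`, `d ≥ 4`, `s ≥ 2n + 3`, `m₁ ≥ ⋯ ≥ m_s > 0` with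
`d ≥ m₁ + 2`, `Σ m_i = nd + 2`, `m₁ + m_{2n+2} ≤ d` and `m₁ + m₂ ≤ d + 1`.  Let
`S = {p₁,…,p_s} ⊂ ℙⁿ` be distinct points in linearly general position and
`Z = Σ m_i p_i`.  Then `h¹(I_Z(d)) = 0` if and only if `S` is not contained in a rational
normal curve of degree `n` of `ℙⁿ`. -/
theorem cc1 {K : Type*} [Field K] [IsAlgClosed K] {n d s : ℕ}
    (hn : 2 ≤ n) (hd : 4 ≤ d) (hs : 2 * n + 3 ≤ s)
    (m : Fin s → ℕ) (hpos : ∀ i, 0 < m i) (hsort : ∀ i j : Fin s, i ≤ j → m j ≤ m i)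
    (hm1 : m ⟨0, by omega⟩ + 2 ≤ d)
    (hsum : (∑ i, m i) = n * d + 2)
    (h2n2 : m ⟨0, by omega⟩ + m ⟨2 * n + 1, by omega⟩ ≤ d)
    (h12 : m ⟨0, by omega⟩ + m ⟨1, by omega⟩ ≤ d + 1)
    (p : Fin s → Projectivization K (Fin (n + 1) → K)) (hinj : Function.Injective p)
    (hlgp : LinGenPos (Set.range p)) :
    H1Zero p m d ↔ ¬∃ C, IsRNC n n C ∧ Set.range p ⊆ C := by
  have hmax : ∀ i, m i ≤ d + 1 := fun i => by
    have := hsort ⟨0, by omega⟩ i (Fin.le_def.2 (Nat.zero_le _))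
    omega
  have : Infinite K := IsAlgClosed.instInfinite
  constructor
  · rintro h ⟨C, hC, hp⟩
    exact not_H1Zero_of_subset_rnc hinj hlgp (by omega) (by omega) hpos hmax hsum hC hp h
  · intro h
    by_contra hH
    refine h (castelnuovo hinj hlgp hs fun G hG h0 x => ?_)
    by_contra hx
    refine hH (H1Zero_of_quadric hinj hlgp hn hd hs hpos hsort hm1 hsum h2n2 h12 ?_ hG hx h0)
    by_contra hlt
    exact hx (h0 x (by omega))
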